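/- Let V = (V_1,…,V_ν)ᵀ and U = (U_1,…,U_ν)ᵀ be centered Gaussian random vectors in ℝ^ν with covariance matrices Σ^V = (Σ^V_{j₁j₂}) and Σ^U = (Σ^U_{j₁j₂}), and set Δ₀ = max_{1≤j₁,j₂≤ν} |Σ^V_{j₁j₂} − Σ^U_{j₁j₂}|. Suppose there exist finite constants 0 < c₁ < C₁ such that max_{1≤j≤ν} E[U_j²] ≤ C₁ and E[max_{1≤j≤ν} U_j] ≥ c₁ √(log ν). Then there exist finite positive constants c₂ and C₂, depending only on c₁ and C₁, such that sup_{t∈ℝ} |P(max_{1≤j≤ν} V_j ≤ t) − P(max_{1≤j≤ν} U_j ≤ t)| ≤ C₂ Δ₀^{1/3} (1 ∨ log(ν/Δ₀))^{2/3} + C₂ ν^{−c₂} √(1 ∨ log(ν/Δ₀)), where a ∨ b = max{a,b}. -/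

import Mathlib

open MeasureTheory ProbabilityTheory

/-- The centered Gaussian law with covariance matrix `S`. -/
noncomputable abbrev centeredGaussian {ι : Type*} [Fintype ι] [DecidableEq ι]
    (S : Matrix ι ι ℝ) : Measure (EuclideanSpace ℝ ι) :=
  multivariateGaussian 0 S

section CenteredGaussian

variable {ι : Type*} [Fintype ι] [DecidableEq ι] {S T : Matrix ι ι ℝ}

lemma charFun_centeredGaussian (hS : S.PosSemidef) (x : EuclideanSpace ℝ ι) :
    charFun (centeredGaussian S) x =
      Complex.exp (-((∑ i, ∑ j, x i * S i j * x j : ℝ) : ℂ) / 2) := by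
  rw [charFun_multivariateGaussian hS]
  congr 1
  simp [dotProduct, Matrix.mulVec, Finset.mul_sum, neg_div, mul_assoc]

lemma quadForm_nonneg {ι : Type*} [Fintype ι] {S : Matrix ι ι ℝ} (hS : S.PosSemidef) (x : ι → ℝ) :
    0 ≤ ∑ i, ∑ j, x i * S i j * x j := by
  have := hS.dotProduct_mulVec_nonneg x
  simpa [dotProduct, Matrix.mulVec, Finset.mul_sum, mul_assoc] using this

/-- A random vector all of whose linear functionals are centered Gaussian with the variances
prescribed by `S` has law `centeredGaussian S`. -/
lemma map_toLp_eq_centeredGaussian {Ω : Type*} {_ : MeasurableSpace Ω} {P : Measure Ω}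
    [IsProbabilityMeasure P] {V : ι → Ω → ℝ} (hV : ∀ j, AEMeasurable (V j) P)
    (hS : S.PosSemidef)
    (h : ∀ a : ι → ℝ, Measure.map (fun ω => ∑ j, a j * V j ω) P =
      gaussianReal 0 (∑ j₁, ∑ j₂, a j₁ * S j₁ j₂ * a j₂).toNNReal) :
    P.map (fun ω => WithLp.toLp 2 (fun j => V j ω)) = centeredGaussian S := by
  have hm : AEMeasurable (fun ω => WithLp.toLp 2 (fun j => V j ω)) P :=
    (PiLp.continuous_toLp 2 _).measurable.comp_aemeasurable (aemeasurable_pi_lambda _ hV)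
  have : IsProbabilityMeasure (P.map (fun ω => WithLp.toLp 2 (fun j => V j ω))) :=
    Measure.isProbabilityMeasure_map hm
  apply Measure.ext_of_charFun
  ext a
  rw [charFun_centeredGaussian hS, charFun_apply, integral_map hm (by fun_prop)]
  have h1 := congrArg (fun m => charFun m 1) (h a)
  simp only at h1
  rw [charFun_apply, integral_map (by fun_prop) (by fun_prop), charFun_gaussianReal] at h1
  have h2 : ((∑ i, ∑ j, a i * S i j * a j).toNNReal : ℝ) = ∑ i, ∑ j, a i * S i j * a j :=
    Real.coe_toNNReal _ (quadForm_nonneg hS _)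
  convert h1 using 3 with ω
  · simp [PiLp.inner_apply, mul_comm]
  · rw [← h2]; simp; ring

lemma aemeasurable_of_linear_gaussian {Ω : Type*} {_ : MeasurableSpace Ω} {P : Measure Ω}
    {V : ι → Ω → ℝ}
    (h : ∀ a : ι → ℝ, Measure.map (fun ω => ∑ j, a j * V j ω) P =
      gaussianReal 0 (∑ j₁, ∑ j₂, a j₁ * S j₁ j₂ * a j₂).toNNReal) (j : ι) :
    AEMeasurable (V j) P := by
  have h1 := h (Pi.single j 1)
  simp only [Pi.single_apply, ite_mul, one_mul, zero_mul, Finset.sum_ite_eq',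
    Finset.mem_univ, if_true] at h1
  refine AEMeasurable.of_map_ne_zero ?_
  rw [h1]
  exact IsProbabilityMeasure.ne_zero _

lemma map_smul_add_smul_centeredGaussian (hS : S.PosSemidef) (hT : T.PosSemidef) (a b : ℝ) :
    ((centeredGaussian S).prod (centeredGaussian T)).map (fun p => a • p.1 + b • p.2) =
      centeredGaussian (a ^ 2 • S + b ^ 2 • T) := by
  have hST : (a ^ 2 • S + b ^ 2 • T).PosSemidef :=
    (hS.smul (sq_nonneg a)).add (hT.smul (sq_nonneg b))
  have : IsProbabilityMeasure (((centeredGaussian S).prod (centeredGaussian T)).map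
      (fun p => a • p.1 + b • p.2)) := Measure.isProbabilityMeasure_map (by fun_prop)
  apply Measure.ext_of_charFun
  ext x
  have e : ((centeredGaussian S).prod (centeredGaussian T)).map (fun p => a • p.1 + b • p.2) =
      ((centeredGaussian S).map (a • ·)) ∗ ((centeredGaussian T).map (b • ·)) := by
    rw [Measure.conv, Measure.map_prod_map _ _ (by fun_prop) (by fun_prop),
      Measure.map_map (by fun_prop) (by fun_prop)]
    rfl
  rw [e, charFun_conv, charFun_map_smul, charFun_map_smul, charFun_centeredGaussian hS,
    charFun_centeredGaussian hT, charFun_centeredGaussian hST, ← Complex.exp_add]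
  congr 1
  have : ∑ i, ∑ j, x i * (a ^ 2 • S + b ^ 2 • T) i j * x j =
      ∑ i, ∑ j, (a • x) i * S i j * (a • x) j + ∑ i, ∑ j, (b • x) i * T i j * (b • x) j := by
    simp only [← Finset.sum_add_distrib]
    refine Finset.sum_congr rfl fun i _ => Finset.sum_congr rfl fun j _ => ?_
    simp; ring
  rw [this]; push_cast; ring

lemma integral_centeredGaussian_add (hS : S.PosSemidef) (hT : T.PosSemidef) (h : ℝ)
    {f : EuclideanSpace ℝ ι → ℝ} (hf : Measurable f) {B : ℝ} (hB : ∀ x, |f x| ≤ B) :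
    ∫ x, f x ∂(centeredGaussian (S + h ^ 2 • T)) =
      ∫ x, ∫ y, f (x + h • y) ∂(centeredGaussian T) ∂(centeredGaussian S) := by
  have := map_smul_add_smul_centeredGaussian hS hT 1 h
  simp only [one_pow, one_smul] at this
  rw [← this, integral_map (by fun_prop) hf.aestronglyMeasurable, integral_prod]
  refine Integrable.of_bound (C := B) ?_ (.of_forall fun x => hB _)
  exact (hf.comp (by fun_prop)).aestronglyMeasurable

lemma memLp_eval_centeredGaussian (j : ι) {p : ENNReal} (hp : p ≠ ⊤) :
    MemLp (fun x => x j) p (centeredGaussian S) :=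
  (IsGaussian.hasGaussianLaw_id (μ := centeredGaussian S)).map_fun
    (EuclideanSpace.proj (𝕜 := ℝ) j) |>.memLp hp

lemma integral_eval_centeredGaussian (j : ι) :
    ∫ x, x j ∂(centeredGaussian S) = 0 := by
  have := (EuclideanSpace.proj (𝕜 := ℝ) j).integral_comp_id_comm
    (IsGaussian.integrable_id (μ := centeredGaussian S))
  simpa using this

lemma integral_mul_centeredGaussian (hS : S.PosSemidef) (i j : ι) :
    ∫ x, x i * x j ∂(centeredGaussian S) = S i j := by
  have := covariance_eval_multivariateGaussian (μ := 0) hS i j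
  rw [covariance_eq_sub (memLp_eval_centeredGaussian i (by simp))
    (memLp_eval_centeredGaussian j (by simp))] at this
  simpa [integral_eval_centeredGaussian] using this

lemma integrable_mul_centeredGaussian (i j : ι) :
    Integrable (fun x => x i * x j) (centeredGaussian S) :=
  (memLp_eval_centeredGaussian i (by simp)).integrable_mul (p := 2) (q := 2)
    (memLp_eval_centeredGaussian j (by simp))

lemma integrable_norm_cube_centeredGaussian :
    Integrable (fun x => ‖x‖ ^ 3) (centeredGaussian S) := by
  have := ((IsGaussian.hasGaussianLaw_id (μ := centeredGaussian S)).memLp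
    (p := 3) (by simp)).integrable_norm_pow (by simp)
  simpa using this

lemma map_eval_centeredGaussian (hS : S.PosSemidef) (j : ι) :
    (centeredGaussian S).map (fun x => x j) = gaussianReal 0 (S j j).toNNReal := by
  simpa using (measurePreserving_eval_multivariateGaussian (μ := 0) hS (i := j)).map_eq

end CenteredGaussian

section Lindeberg

variable {ι : Type*} [Fintype ι] [DecidableEq ι] {S T : Matrix ι ι ℝ}

lemma abs_integral_sub_taylor_le (hT : T.PosSemidef) {f : EuclideanSpace ℝ ι → ℝ}
    (hf : Measurable f) {B : ℝ} (hB : ∀ x, |f x| ≤ B) (x : EuclideanSpace ℝ ι)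
    {C : ℝ} (ℓ : ι → ℝ) (q : ι → ι → ℝ)
    (hexp : ∀ y : EuclideanSpace ℝ ι, |f (x + y) - f x - ∑ i, ℓ i * y i
      - (∑ i, ∑ j, q i j * (y i * y j)) / 2| ≤ C * ‖y‖ ^ 3) {h : ℝ} (hh : 0 ≤ h) :
    |∫ y, f (x + h • y) ∂(centeredGaussian T) - (f x + h ^ 2 * ((∑ i, ∑ j, q i j * T i j) / 2))|
      ≤ C * h ^ 3 * ∫ y, ‖y‖ ^ 3 ∂(centeredGaussian T) := by
  have i1 : Integrable (fun y => f (x + h • y)) (centeredGaussian T) :=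
    Integrable.of_bound (C := B) ((hf.comp (by fun_prop)).aestronglyMeasurable)
      (.of_forall fun y => hB _)
  have il : Integrable (fun y : EuclideanSpace ℝ ι => ∑ i, ℓ i * (h * y i))
      (centeredGaussian T) :=
    integrable_finsetSum _ fun i _ => (((memLp_eval_centeredGaussian i
      (p := 1) (by simp)).integrable le_rfl).const_mul h).const_mul _
  have iq : Integrable (fun y : EuclideanSpace ℝ ι =>
      (∑ i, ∑ j, q i j * (h ^ 2 * (y i * y j))) / 2) (centeredGaussian T) :=
    (integrable_finsetSum _ fun i _ => integrable_finsetSum _ fun j _ =>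
      ((integrable_mul_centeredGaussian i j).const_mul _).const_mul _).div_const 2
  have i2 : Integrable (fun y => f (x + h • y) - f x) (centeredGaussian T) :=
    i1.sub (integrable_const _)
  have i3 : Integrable (fun y => f (x + h • y) - f x - ∑ i, ℓ i * (h * y i))
      (centeredGaussian T) := i2.sub il
  have el : ∫ y, (∑ i, ℓ i * (h * y i)) ∂(centeredGaussian T) = 0 := by
    rw [integral_finsetSum _ fun i _ => (((memLp_eval_centeredGaussian i
      (p := 1) (by simp)).integrable le_rfl).const_mul h).const_mul _]
    refine Finset.sum_eq_zero fun i _ => ?_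
    rw [integral_const_mul, integral_const_mul, integral_eval_centeredGaussian]; simp
  have eq : ∫ y, (∑ i, ∑ j, q i j * (h ^ 2 * (y i * y j))) / 2 ∂(centeredGaussian T) =
      h ^ 2 * ((∑ i, ∑ j, q i j * T i j) / 2) := by
    rw [integral_div, integral_finsetSum _ fun i _ => integrable_finsetSum _ fun j _ =>
      ((integrable_mul_centeredGaussian i j).const_mul _).const_mul _]
    rw [← mul_div_assoc, Finset.mul_sum]
    congr 1
    refine Finset.sum_congr rfl fun i _ => ?_
    rw [integral_finsetSum _ fun j _ =>
      ((integrable_mul_centeredGaussian i j).const_mul _).const_mul _, Finset.mul_sum]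
    refine Finset.sum_congr rfl fun j _ => ?_
    rw [integral_const_mul, integral_const_mul, integral_mul_centeredGaussian hT]; ring
  have key : ∫ y, f (x + h • y) ∂(centeredGaussian T)
      - (f x + h ^ 2 * ((∑ i, ∑ j, q i j * T i j) / 2)) =
      ∫ y, (f (x + h • y) - f x - (∑ i, ℓ i * (h * y i)) -
        (∑ i, ∑ j, q i j * (h ^ 2 * (y i * y j))) / 2) ∂(centeredGaussian T) := by
    rw [integral_sub i3 iq, integral_sub i2 il, integral_sub i1 (integrable_const _), el, eq]
    simp; ring
  rw [key, ← integral_const_mul]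
  refine (abs_integral_le_integral_abs).trans (integral_mono ?_ ?_ fun y => ?_)
  · exact (i3.sub iq).abs
  · exact integrable_norm_cube_centeredGaussian.const_mul _
  · have := hexp (h • y)
    rw [norm_smul, Real.norm_of_nonneg hh, mul_pow, ← mul_assoc] at this
    refine le_trans (le_of_eq ?_) this
    simp only [PiLp.smul_apply, smul_eq_mul]
    congr 4
    ext i
    refine Finset.sum_congr rfl fun j _ => ?_
    ring

/-- Lindeberg-type comparison of two centered Gaussian laws on a test function with a
second order expansion whose quadratic part is summable with sum at most `K`. -/
lemma abs_integral_sub_integral_centeredGaussian_le (hS : S.PosSemidef) (hT : T.PosSemidef)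
    {f : EuclideanSpace ℝ ι → ℝ} (hf : Measurable f) {B : ℝ} (hB : ∀ x, |f x| ≤ B)
    {C K Δ : ℝ} (hΔ0 : 0 ≤ Δ) (hΔ : ∀ i j, |S i j - T i j| ≤ Δ)
    (hexp : ∀ x : EuclideanSpace ℝ ι, ∃ (ℓ : ι → ℝ) (q : ι → ι → ℝ), ∑ i, ∑ j, |q i j| ≤ K ∧
      ∀ y : EuclideanSpace ℝ ι, |f (x + y) - f x - ∑ i, ℓ i * y i
        - (∑ i, ∑ j, q i j * (y i * y j)) / 2| ≤ C * ‖y‖ ^ 3) :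
    |∫ x, f x ∂(centeredGaussian S) - ∫ x, f x ∂(centeredGaussian T)| ≤ K * Δ / 2 := by
  set m : ℝ := C * (∫ y, ‖y‖ ^ 3 ∂(centeredGaussian S) + ∫ y, ‖y‖ ^ 3 ∂(centeredGaussian T))
  have step : ∀ (R : Matrix ι ι ℝ), R.PosSemidef → ∀ h : ℝ, 0 ≤ h →
      |∫ x, f x ∂(centeredGaussian (R + h ^ 2 • S)) -
        ∫ x, f x ∂(centeredGaussian (R + h ^ 2 • T))| ≤ h ^ 2 * (K * Δ / 2) + h ^ 3 * m := by
    intro R hR h hh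
    have im : ∀ U : Matrix ι ι ℝ, Integrable
        (fun x => ∫ y, f (x + h • y) ∂(centeredGaussian U)) (centeredGaussian R) := by
      intro U
      refine Integrable.of_bound (C := B) ?_ (.of_forall fun x => ?_)
      · have : Measurable (fun p : EuclideanSpace ℝ ι × EuclideanSpace ℝ ι => f (p.1 + h • p.2)) :=
          hf.comp (by fun_prop)
        exact (this.stronglyMeasurable.integral_prod_right).aestronglyMeasurable
      · have := norm_integral_le_of_norm_le_const (μ := centeredGaussian U)
          (f := fun y => f (x + h • y)) (C := B) (.of_forall fun y => hB _)
        simpa using this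
    rw [integral_centeredGaussian_add hR hS h hf hB, integral_centeredGaussian_add hR hT h hf hB,
      ← integral_sub (im S) (im T)]
    have := norm_integral_le_of_norm_le_const (μ := centeredGaussian R)
      (f := fun x => ∫ y, f (x + h • y) ∂(centeredGaussian S) -
        ∫ y, f (x + h • y) ∂(centeredGaussian T)) (C := h ^ 2 * (K * Δ / 2) + h ^ 3 * m)
        (.of_forall fun x => ?_)
    · simpa using this
    obtain ⟨ℓ, q, hq, hy⟩ := hexp x
    have e1 := abs_integral_sub_taylor_le hS hf hB x ℓ q hy hh
    have e2 := abs_integral_sub_taylor_le hT hf hB x ℓ q hy hh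
    have e3 : |∑ i, ∑ j, q i j * S i j - ∑ i, ∑ j, q i j * T i j| ≤ K * Δ := by
      rw [← Finset.sum_sub_distrib]
      simp_rw [← Finset.sum_sub_distrib, ← mul_sub]
      refine (Finset.abs_sum_le_sum_abs _ _).trans ?_
      refine le_trans ?_ (mul_le_mul_of_nonneg_right hq hΔ0)
      rw [Finset.sum_mul]
      refine Finset.sum_le_sum fun i _ => (Finset.abs_sum_le_sum_abs _ _).trans ?_
      rw [Finset.sum_mul]
      refine Finset.sum_le_sum fun j _ => ?_
      rw [abs_mul]
      exact mul_le_mul_of_nonneg_left (hΔ i j) (abs_nonneg _)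
    have e4 : |h ^ 2 * ((∑ i, ∑ j, q i j * S i j) / 2) - h ^ 2 * ((∑ i, ∑ j, q i j * T i j) / 2)|
        ≤ h ^ 2 * (K * Δ / 2) := by
      rw [← mul_sub, ← sub_div, abs_mul, abs_of_nonneg (sq_nonneg h), abs_div, abs_two]
      gcongr
    simp only [Real.norm_eq_abs, m]
    rw [abs_le] at *
    constructor <;> linarith [e1.1, e1.2, e2.1, e2.2, e4.1, e4.2]
  have tel : ∀ n : ℕ, 0 < n →
      |∫ x, f x ∂(centeredGaussian S) - ∫ x, f x ∂(centeredGaussian T)| ≤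
        K * Δ / 2 + Real.sqrt (1 / n) * m := by
    intro n hn
    have hn' : (0 : ℝ) < n := by exact_mod_cast hn
    let A : ℕ → Matrix ι ι ℝ := fun k => (1 - k / n : ℝ) • S + (k / n : ℝ) • T
    have hk : ∀ k ∈ Finset.range n, |∫ x, f x ∂(centeredGaussian (A (k + 1))) -
        ∫ x, f x ∂(centeredGaussian (A k))| ≤ (1 / n) * (K * Δ / 2 + Real.sqrt (1 / n) * m) := by
      intro k hk
      have hkn : ((k + 1 : ℕ) : ℝ) ≤ n := by exact_mod_cast Finset.mem_range.mp hk
      have hkn' : ((k + 1 : ℕ) : ℝ) / n ≤ 1 := (div_le_one hn').2 hkn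
      have hR : ((1 - ((k + 1 : ℕ) : ℝ) / n) • S + (k / n : ℝ) • T).PosSemidef :=
        (hS.smul (by linarith)).add (hT.smul (by positivity))
      have := step _ hR (Real.sqrt (1 / n)) (Real.sqrt_nonneg _)
      have hsq : Real.sqrt (1 / n) ^ 2 = 1 / (n : ℝ) := Real.sq_sqrt (by positivity)
      rw [pow_succ _ 2, hsq] at this
      rw [abs_sub_comm]
      convert this using 3
      · congr 2
        ext i j; simp [A]; field_simp; ring
      · congr 2
        ext i j; simp [A]; field_simp; ring
      · ring
    have h0 : A 0 = S := by ext i j; simp [A]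
    have h1 : A n = T := by ext i j; simp [A, hn'.ne']
    rw [abs_sub_comm, ← h0, ← h1,
      ← Finset.sum_range_sub (fun k => ∫ x, f x ∂(centeredGaussian (A k)))]
    refine (Finset.abs_sum_le_sum_abs _ _).trans ((Finset.sum_le_sum hk).trans (le_of_eq ?_))
    rw [Finset.sum_const, Finset.card_range, nsmul_eq_mul]
    field_simp
  have lim : Filter.Tendsto (fun n : ℕ => K * Δ / 2 + Real.sqrt (1 / n) * m) Filter.atTop
      (nhds (K * Δ / 2 + Real.sqrt 0 * m)) :=
    ((tendsto_one_div_atTop_nhds_zero_nat.sqrt).mul_const m).const_add _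
  rw [Real.sqrt_zero, zero_mul, add_zero] at lim
  exact ge_of_tendsto lim (Filter.eventually_atTop.2 ⟨1, fun n hn => tel n hn⟩)

end Lindeberg

section SmoothMax

lemma exists_smooth_step : ∃ (G : ℝ) (g g₁ g₂ g₃ : ℝ → ℝ), 0 < G ∧
    (∀ u, HasDerivAt g (g₁ u) u) ∧ (∀ u, HasDerivAt g₁ (g₂ u) u) ∧
    (∀ u, HasDerivAt g₂ (g₃ u) u) ∧ (∀ u, |g₁ u| ≤ G) ∧ (∀ u, |g₂ u| ≤ G) ∧
    (∀ u, |g₃ u| ≤ G) ∧ (∀ u, 0 ≤ g u) ∧ (∀ u, g u ≤ 1) ∧ (∀ u ≤ 1, g u = 1) ∧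
    (∀ u, 2 ≤ u → g u = 0) := by
  let g : ℝ → ℝ := fun u => Real.smoothTransition (2 - u)
  have hg : ContDiff ℝ (1 + 1 + 1 + 1) g := Real.smoothTransition.contDiff.comp (by fun_prop)
  have hg1 : ContDiff ℝ (1 + 1 + 1) (deriv g) := hg.deriv'
  have hg2 : ContDiff ℝ (1 + 1) (deriv (deriv g)) := hg1.deriv'
  have hg3 : ContDiff ℝ 1 (deriv (deriv (deriv g))) := hg2.deriv'
  have c1 : HasCompactSupport (deriv g) := by
    refine HasCompactSupport.intro (isCompact_Icc (a := 1) (b := 2)) fun u hu => ?_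
    rw [Set.mem_Icc, not_and_or, not_le, not_le] at hu
    rcases hu with hu | hu
    · have : g =ᶠ[nhds u] fun _ => 1 := by
        filter_upwards [Iio_mem_nhds hu] with v hv
        exact Real.smoothTransition.one_of_one_le (by linarith [Set.mem_Iio.1 hv])
      rw [this.deriv_eq]; simp
    · have : g =ᶠ[nhds u] fun _ => 0 := by
        filter_upwards [Ioi_mem_nhds hu] with v hv
        exact Real.smoothTransition.zero_of_nonpos (by linarith [Set.mem_Ioi.1 hv])
      rw [this.deriv_eq]; simp
  obtain ⟨G1, h1⟩ := c1.exists_bound_of_continuous hg1.continuous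
  obtain ⟨G2, h2⟩ := c1.deriv.exists_bound_of_continuous hg2.continuous
  obtain ⟨G3, h3⟩ := c1.deriv.deriv.exists_bound_of_continuous hg3.continuous
  refine ⟨|G1| + |G2| + |G3| + 1, g, deriv g, deriv (deriv g), deriv (deriv (deriv g)),
    by positivity, fun u => (hg.differentiable (by simp) u).hasDerivAt,
    fun u => (hg1.differentiable (by simp) u).hasDerivAt,
    fun u => (hg2.differentiable (by simp) u).hasDerivAt,
    fun u => ?_, fun u => ?_, fun u => ?_, fun u => Real.smoothTransition.nonneg _,
    fun u => Real.smoothTransition.le_one _,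
    fun u hu => Real.smoothTransition.one_of_one_le (by linarith),
    fun u hu => Real.smoothTransition.zero_of_nonpos (by linarith)⟩
  · have := h1 u; rw [Real.norm_eq_abs] at this
    linarith [le_abs_self G1, abs_nonneg G2, abs_nonneg G3]
  · have := h2 u; rw [Real.norm_eq_abs] at this
    linarith [le_abs_self G2, abs_nonneg G1, abs_nonneg G3]
  · have := h3 u; rw [Real.norm_eq_abs] at this
    linarith [le_abs_self G3, abs_nonneg G2, abs_nonneg G1]

lemma abs_sub_le_of_hasDerivAt_le {ψ ψ' : ℝ → ℝ} {M : ℝ} (hψ : ∀ s, HasDerivAt ψ (ψ' s) s)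
    (hM : ∀ s ∈ Set.Icc (0 : ℝ) 1, |ψ' s| ≤ M) {s : ℝ} (hs : s ∈ Set.Icc (0 : ℝ) 1) :
    |ψ s - ψ 0| ≤ M := by
  have := Convex.norm_image_sub_le_of_norm_hasDerivWithin_le (f := ψ) (f' := ψ') (C := M)
    (s := Set.Icc (0 : ℝ) 1) (fun x _ => (hψ x).hasDerivWithinAt) hM (convex_Icc 0 1)
    (Set.left_mem_Icc.2 zero_le_one) hs
  rw [Real.norm_eq_abs, Real.norm_eq_abs, sub_zero, abs_of_nonneg hs.1] at this
  have hM0 : 0 ≤ M := (abs_nonneg _).trans (hM s hs)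
  nlinarith [hs.2]

lemma abs_taylor_two_le {φ φ₁ φ₂ φ₃ : ℝ → ℝ} {M : ℝ} (h : ∀ s, HasDerivAt φ (φ₁ s) s)
    (h₁ : ∀ s, HasDerivAt φ₁ (φ₂ s) s) (h₂ : ∀ s, HasDerivAt φ₂ (φ₃ s) s)
    (hM : ∀ s, |φ₃ s| ≤ M) : |φ 1 - φ 0 - φ₁ 0 - φ₂ 0 / 2| ≤ M := by
  have e2 : ∀ s ∈ Set.Icc (0 : ℝ) 1, |φ₂ s - φ₂ 0| ≤ M := fun s hs =>
    abs_sub_le_of_hasDerivAt_le h₂ (fun s _ => hM s) hs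
  have e1 : ∀ s ∈ Set.Icc (0 : ℝ) 1, |φ₁ s - φ₁ 0 - s * φ₂ 0| ≤ M := fun s hs => by
    have := abs_sub_le_of_hasDerivAt_le (ψ := fun s => φ₁ s - s * φ₂ 0)
      (fun s => (h₁ s).sub ((hasDerivAt_id s).mul_const (φ₂ 0))) (by simpa using e2) hs
    convert this using 2; simp; ring
  have := abs_sub_le_of_hasDerivAt_le (ψ := fun s => φ s - s * φ₁ 0 - s ^ 2 * (φ₂ 0 / 2))
      (ψ' := fun s => φ₁ s - φ₁ 0 - s * φ₂ 0) (M := M) (fun s => ?_) e1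
      (Set.right_mem_Icc.2 zero_le_one)
  · convert this using 2; simp; ring
  · refine (((h s).sub ((hasDerivAt_id s).mul_const (φ₁ 0))).sub
      ((hasDerivAt_pow 2 s).mul_const (φ₂ 0 / 2))).congr_deriv ?_
    simp; ring

variable {ι : Type*} [Fintype ι]

lemma hasDerivAt_expSum (c y : ι → ℝ) (β : ℝ) (k : ℕ) (s : ℝ) :
    HasDerivAt (fun s => ∑ j, y j ^ k * Real.exp (β * (c j + s * y j)))
      (β * ∑ j, y j ^ (k + 1) * Real.exp (β * (c j + s * y j))) s := by
  rw [Finset.mul_sum]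
  refine HasDerivAt.fun_sum fun j _ => ?_
  have h : HasDerivAt (fun s : ℝ => β * (c j + s * y j)) (β * (1 * y j)) s :=
    (((hasDerivAt_id s).mul_const (y j)).const_add (c j)).const_mul β
  refine (h.exp.const_mul (y j ^ k)).congr_deriv ?_
  ring

/-- Along the line `s ↦ c + s y`, the smoothed maximum composed with a smooth function has a
controlled second order expansion. -/
lemma abs_taylor_softmax_le [Nonempty ι] {G : ℝ} {g g₁ g₂ g₃ : ℝ → ℝ}
    (hg : ∀ u, HasDerivAt g (g₁ u) u) (hg₁ : ∀ u, HasDerivAt g₁ (g₂ u) u)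
    (hg₂ : ∀ u, HasDerivAt g₂ (g₃ u) u) (b₁ : ∀ u, |g₁ u| ≤ G) (b₂ : ∀ u, |g₂ u| ≤ G)
    (b₃ : ∀ u, |g₃ u| ≤ G) {β L : ℝ} (hβ : 0 ≤ β) (hL : 1 ≤ L) (c y : ι → ℝ) {Y : ℝ}
    (hY : ∀ j, |y j| ≤ Y) {u₀ m₁ m₂ : ℝ}
    (hu : u₀ = Real.log (∑ j, Real.exp (β * c j)) / L)
    (hm₁ : m₁ = (∑ j, y j * Real.exp (β * c j)) / ∑ j, Real.exp (β * c j))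
    (hm₂ : m₂ = (∑ j, y j ^ 2 * Real.exp (β * c j)) / ∑ j, Real.exp (β * c j)) :
    |g (Real.log (∑ j, Real.exp (β * (c j + y j))) / L) - g u₀ - g₁ u₀ * (β / L * m₁)
      - (g₂ u₀ * (β / L * m₁) ^ 2 + g₁ u₀ * (β ^ 2 / L * (m₂ - m₁ ^ 2))) / 2|
      ≤ 13 * G * β ^ 3 * Y ^ 3 := by
  let A : ℕ → ℝ → ℝ := fun k s => ∑ j, y j ^ k * Real.exp (β * (c j + s * y j))
  have hA : ∀ k s, HasDerivAt (A k) (β * A (k + 1) s) s := fun k s => hasDerivAt_expSum c y β k s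
  have hpos : ∀ s, 0 < A 0 s := fun s => Finset.sum_pos (fun j _ => by positivity)
    Finset.univ_nonempty
  have hY0 : 0 ≤ Y := (abs_nonneg _).trans (hY (Classical.arbitrary ι))
  have hG0 : 0 ≤ G := (abs_nonneg _).trans (b₁ 0)
  have hL0 : 0 < L := by linarith
  let m : ℕ → ℝ → ℝ := fun k s => A k s / A 0 s
  have hmb : ∀ k s, |m k s| ≤ Y ^ k := by
    intro k s
    rw [abs_div, abs_of_pos (hpos s), div_le_iff₀ (hpos s), Finset.mul_sum]
    refine (Finset.abs_sum_le_sum_abs _ _).trans (Finset.sum_le_sum fun j _ => ?_)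
    rw [abs_mul, abs_pow, Real.abs_exp, pow_zero, one_mul]
    exact mul_le_mul_of_nonneg_right (pow_le_pow_left₀ (abs_nonneg _) (hY j) k) (by positivity)
  have hm : ∀ k s, HasDerivAt (m k) (β * (m (k + 1) s - m k s * m 1 s)) s := by
    intro k s
    refine ((hA k s).div (hA 0 s) (hpos s).ne').congr_deriv ?_
    have := (hpos s).ne'
    simp only [m, zero_add]
    field_simp
  let u : ℝ → ℝ := fun s => Real.log (A 0 s) / L
  have hu' : ∀ s, HasDerivAt u (β / L * m 1 s) s := by
    intro s
    refine (((hA 0 s).log (hpos s).ne').div_const L).congr_deriv ?_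
    simp only [m, zero_add]; ring
  have hφ : ∀ s, HasDerivAt (fun s => g (u s)) (g₁ (u s) * (β / L * m 1 s)) s :=
    fun s => (hg (u s)).comp s (hu' s)
  have hφ₁ : ∀ s, HasDerivAt (fun s => g₁ (u s) * (β / L * m 1 s))
      (g₂ (u s) * (β / L * m 1 s) ^ 2 + g₁ (u s) * (β ^ 2 / L * (m 2 s - m 1 s ^ 2))) s := by
    intro s
    refine (((hg₁ (u s)).comp s (hu' s)).mul ((hm 1 s).const_mul (β / L))).congr_deriv ?_
    simp only [Function.comp]; ring
  have hφ₂ : ∀ s, HasDerivAt (fun s => g₂ (u s) * (β / L * m 1 s) ^ 2 +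
      g₁ (u s) * (β ^ 2 / L * (m 2 s - m 1 s ^ 2)))
      (g₃ (u s) * (β / L * m 1 s) ^ 3
        + 3 * g₂ (u s) * (β / L * m 1 s) * (β ^ 2 / L * (m 2 s - m 1 s ^ 2))
        + g₁ (u s) * (β ^ 3 / L * (m 3 s - 3 * (m 2 s * m 1 s) + 2 * m 1 s ^ 3))) s := by
    intro s
    refine ((((hg₂ (u s)).comp s (hu' s)).mul (((hm 1 s).const_mul (β / L)).pow 2)).add
      (((hg₁ (u s)).comp s (hu' s)).mul
        (((hm 2 s).sub ((hm 1 s).pow 2)).const_mul (β ^ 2 / L)))).congr_deriv ?_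
    simp only [Function.comp, Pi.pow_apply, Pi.sub_apply]; ring
  have bound : ∀ s, |g₃ (u s) * (β / L * m 1 s) ^ 3
        + 3 * g₂ (u s) * (β / L * m 1 s) * (β ^ 2 / L * (m 2 s - m 1 s ^ 2))
        + g₁ (u s) * (β ^ 3 / L * (m 3 s - 3 * (m 2 s * m 1 s) + 2 * m 1 s ^ 3))|
      ≤ 13 * G * β ^ 3 * Y ^ 3 := by
    intro s
    have a1 := hmb 1 s
    rw [pow_one] at a1
    have a2 := hmb 2 s
    have a3 := hmb 3 s
    have d1 : |m 2 s - m 1 s ^ 2| ≤ 2 * Y ^ 2 := by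
      have : |m 1 s ^ 2| ≤ Y ^ 2 := by
        rw [abs_pow]; exact pow_le_pow_left₀ (abs_nonneg _) a1 2
      exact (abs_sub _ _).trans (by linarith)
    have d2 : |m 3 s - 3 * (m 2 s * m 1 s) + 2 * m 1 s ^ 3| ≤ 6 * Y ^ 3 := by
      have e1 : |2 * m 1 s ^ 3| ≤ 2 * Y ^ 3 := by
        rw [abs_mul, abs_pow, abs_two]
        have := pow_le_pow_left₀ (abs_nonneg _) a1 3
        linarith
      have e2 : |3 * (m 2 s * m 1 s)| ≤ 3 * Y ^ 3 := by
        rw [abs_mul, abs_mul, abs_of_pos (by norm_num : (0 : ℝ) < 3)]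
        have := mul_le_mul a2 a1 (abs_nonneg _) (by positivity)
        nlinarith
      refine (abs_add_le _ _).trans ?_
      linarith [abs_sub (m 3 s) (3 * (m 2 s * m 1 s))]
    have l1 : β / L ≤ β := div_le_self hβ hL
    have l2 : β ^ 2 / L ≤ β ^ 2 := div_le_self (by positivity) hL
    have l3 : β ^ 3 / L ≤ β ^ 3 := div_le_self (by positivity) hL
    have p1 : |β / L * m 1 s| ≤ β * Y := by
      rw [abs_mul, abs_of_nonneg (by positivity)]
      exact mul_le_mul l1 a1 (abs_nonneg _) hβ
    have p2 : |β ^ 2 / L * (m 2 s - m 1 s ^ 2)| ≤ β ^ 2 * (2 * Y ^ 2) := by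
      rw [abs_mul, abs_of_nonneg (by positivity)]
      exact mul_le_mul l2 d1 (abs_nonneg _) (by positivity)
    have p3 : |β ^ 3 / L * (m 3 s - 3 * (m 2 s * m 1 s) + 2 * m 1 s ^ 3)| ≤ β ^ 3 * (6 * Y ^ 3) := by
      rw [abs_mul, abs_of_nonneg (by positivity)]
      exact mul_le_mul l3 d2 (abs_nonneg _) (by positivity)
    have t1 : |g₃ (u s) * (β / L * m 1 s) ^ 3| ≤ G * (β * Y) ^ 3 := by
      rw [abs_mul, abs_pow]
      exact mul_le_mul (b₃ _) (pow_le_pow_left₀ (abs_nonneg _) p1 3) (by positivity) hG0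
    have t2 : |3 * g₂ (u s) * (β / L * m 1 s) * (β ^ 2 / L * (m 2 s - m 1 s ^ 2))| ≤
        3 * G * (β * Y) * (β ^ 2 * (2 * Y ^ 2)) := by
      rw [abs_mul, abs_mul, abs_mul, abs_of_pos (by norm_num : (0 : ℝ) < 3)]
      have := b₂ (u s)
      gcongr
    have t3 : |g₁ (u s) * (β ^ 3 / L * (m 3 s - 3 * (m 2 s * m 1 s) + 2 * m 1 s ^ 3))| ≤
        G * (β ^ 3 * (6 * Y ^ 3)) := by
      rw [abs_mul]
      exact mul_le_mul (b₁ _) p3 (abs_nonneg _) hG0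
    refine (abs_add_le _ _).trans ((add_le_add_left (abs_add_le _ _) _).trans ?_)
    calc _ ≤ G * (β * Y) ^ 3 + 3 * G * (β * Y) * (β ^ 2 * (2 * Y ^ 2)) +
          G * (β ^ 3 * (6 * Y ^ 3)) := by linarith
      _ = _ := by ring
  have := abs_taylor_two_le hφ hφ₁ hφ₂ bound
  have z0 : u 0 = u₀ := by simp [u, A, hu]
  have z1 : m 1 0 = m₁ := by simp [m, A, hm₁]
  have z2 : m 2 0 = m₂ := by simp [m, A, hm₂]
  have z3 : u 1 = Real.log (∑ j, Real.exp (β * (c j + y j))) / L := by simp [u, A]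
  simpa only [z0, z1, z2, z3] using this

end SmoothMax

section SmoothComparison

variable {ι : Type*} [Fintype ι] [DecidableEq ι] {S T : Matrix ι ι ℝ}

lemma measurable_iSup_eval {ι : Type*} [Fintype ι] :
    Measurable fun x : EuclideanSpace ℝ ι => ⨆ j, x j :=
  Measurable.iSup fun j => by fun_prop

lemma measurableSet_iSup_eval_le {ι : Type*} [Fintype ι] (t : ℝ) :
    MeasurableSet {x : EuclideanSpace ℝ ι | ⨆ j, x j ≤ t} :=
  measurable_iSup_eval measurableSet_Iic

/-- Coefficients of the quadratic form in the second-order expansion of the smoothed maximum: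
a rank-one part plus a diagonal part. -/
lemma sum_abs_rankOne_add_diagonal_le (a b : ℝ) {p : ι → ℝ} (hp : ∀ i, 0 ≤ p i)
    (hp1 : ∑ i, p i = 1) :
    ∑ i, ∑ j, |a * (p i * p j) + if i = j then b * p i else 0| ≤ |a| + |b| := by
  calc ∑ i, ∑ j, |a * (p i * p j) + if i = j then b * p i else 0|
      ≤ ∑ i, ∑ j, (|a| * (p i * p j) + if i = j then |b| * p i else 0) := by
        gcongr with i _ j _
        refine (abs_add_le _ _).trans (add_le_add ?_ ?_)
        · rw [abs_mul, abs_of_nonneg (mul_nonneg (hp i) (hp j))]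
        · split_ifs
          · rw [abs_mul, abs_of_nonneg (hp i)]
          · simp
    _ = |a| + |b| := by
        simp [Finset.sum_add_distrib, ← Finset.mul_sum, hp1]

lemma sum_rankOne_add_diagonal_mul (a b : ℝ) (p y : ι → ℝ) :
    ∑ i, ∑ j, (a * (p i * p j) + if i = j then b * p i else 0) * (y i * y j)
      = a * (∑ i, y i * p i) ^ 2 + b * ∑ i, y i ^ 2 * p i := by
  simp only [add_mul, Finset.sum_add_distrib, ite_mul, zero_mul, Finset.sum_ite_eq,
    Finset.mem_univ, if_true]
  congr 1
  · rw [sq, Finset.sum_mul_sum, Finset.mul_sum]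
    refine Finset.sum_congr rfl fun i _ => ?_
    rw [Finset.mul_sum]
    exact Finset.sum_congr rfl fun j _ => by ring
  · rw [Finset.mul_sum]
    exact Finset.sum_congr rfl fun j _ => by ring

lemma log_sum_exp_bounds {ι : Type*} [Fintype ι] [Nonempty ι] {β : ℝ} (hβ : 0 ≤ β) (c : ι → ℝ) :
    β * (⨆ j, c j) ≤ Real.log (∑ j, Real.exp (β * c j)) ∧
      Real.log (∑ j, Real.exp (β * c j)) ≤ β * (⨆ j, c j) + Real.log (Fintype.card ι) := by
  have hpos : 0 < ∑ j, Real.exp (β * c j) :=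
    Finset.sum_pos (fun _ _ => Real.exp_pos _) Finset.univ_nonempty
  constructor
  · obtain ⟨j, hj⟩ := exists_eq_ciSup_of_finite (f := c)
    rw [← hj, Real.le_log_iff_exp_le hpos]
    exact Finset.single_le_sum (f := fun j => Real.exp (β * c j))
      (fun _ _ => (Real.exp_pos _).le) (Finset.mem_univ j)
  · rw [Real.log_le_iff_le_exp hpos, Real.exp_add,
      Real.exp_log (by exact_mod_cast Fintype.card_pos), mul_comm]
    calc ∑ j, Real.exp (β * c j) ≤ ∑ _j : ι, Real.exp (β * ⨆ j, c j) := by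
          gcongr with j
          exact le_ciSup (Set.finite_range c).bddAbove j
      _ = _ := by simp

/-- Comparison of the distribution functions of the maxima of two Gaussian vectors whose
covariance matrices are entrywise close, up to a shift of the level. -/
lemma exists_measureReal_iSup_le_comparison : ∃ G : ℝ, 0 < G ∧
    ∀ {ι : Type} [Fintype ι] [DecidableEq ι] [Nonempty ι] {S T : Matrix ι ι ℝ},
      S.PosSemidef → T.PosSemidef → ∀ {Δ L ε : ℝ}, 0 ≤ Δ → (∀ i j, |S i j - T i j| ≤ Δ) →
      1 ≤ L → Real.log (Fintype.card ι) ≤ L → 0 < ε → ∀ t : ℝ,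
      (centeredGaussian S).real {x | ⨆ j, x j ≤ t} ≤
        (centeredGaussian T).real {x | ⨆ j, x j ≤ t + 2 * ε} + G * (Δ * L / ε ^ 2) := by
  obtain ⟨G, g, g₁, g₂, g₃, hG, hg, hg₁, hg₂, b₁, b₂, b₃, g0, g1, gl, gr⟩ := exists_smooth_step
  refine ⟨3 / 2 * G, by positivity, ?_⟩
  intro ι _ _ _ S T hS hT Δ L ε hΔ0 hΔ hL hcard hε t
  have hL0 : 0 < L := by linarith
  set β := L / ε with hβd
  have hβ : 0 < β := by positivity
  let f : EuclideanSpace ℝ ι → ℝ :=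
    fun x => g (Real.log (∑ j, Real.exp (β * (x j - t))) / L)
  have hgm : Measurable g :=
    (continuous_iff_continuousAt.2 fun u => (hg u).continuousAt).measurable
  have hf : Measurable f := by
    apply hgm.comp
    fun_prop
  have hB : ∀ x, |f x| ≤ 1 := fun x => by
    rw [abs_of_nonneg (g0 _)]; exact g1 _
  have hsup : ∀ x : EuclideanSpace ℝ ι, (⨆ j, (x j - t)) = (⨆ j, x j) - t := fun x => by
    simp only [sub_eq_add_neg]
    exact (ciSup_add (Set.finite_range _).bddAbove _).symm
  have hone : ∀ x : EuclideanSpace ℝ ι, ⨆ j, x j ≤ t → f x = 1 := fun x hx => by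
    apply gl
    have := (log_sum_exp_bounds hβ.le (fun j => x j - t)).2
    rw [hsup] at this
    rw [div_le_one hL0]
    nlinarith
  have hzero : ∀ x : EuclideanSpace ℝ ι, t + 2 * ε < ⨆ j, x j → f x = 0 := fun x hx => by
    apply gr
    have := (log_sum_exp_bounds hβ.le (fun j => x j - t)).1
    rw [hsup] at this
    rw [le_div_iff₀ hL0]
    have h2 : β * (2 * ε) ≤ β * ((⨆ j, x j) - t) := by gcongr; linarith
    have h3 : β * (2 * ε) = 2 * L := by rw [hβd]; field_simp
    linarith
  have key := abs_integral_sub_integral_centeredGaussian_le hS hT hf hB (C := 13 * G * β ^ 3)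
    (K := 3 * G * (β ^ 2 / L)) hΔ0 hΔ ?_
  · have hSi : (centeredGaussian S).real {x | ⨆ j, x j ≤ t} ≤ ∫ x, f x ∂(centeredGaussian S) := by
      rw [← integral_indicator_one (measurableSet_iSup_eval_le _)]
      refine integral_mono_of_nonneg (ae_of_all _ fun x => ?_)
        (Integrable.of_bound hf.aestronglyMeasurable 1 (ae_of_all _ hB)) (ae_of_all _ fun x => ?_)
      · exact Set.indicator_nonneg (fun _ _ => zero_le_one) _
      · by_cases hx : ⨆ j, x j ≤ t
        · rw [Set.indicator_of_mem (by exact hx)]; exact (hone x hx).ge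
        · rw [Set.indicator_of_notMem (by exact hx)]; exact g0 _
    have hTi : ∫ x, f x ∂(centeredGaussian T) ≤
        (centeredGaussian T).real {x | ⨆ j, x j ≤ t + 2 * ε} := by
      rw [← integral_indicator_one (measurableSet_iSup_eval_le _)]
      refine integral_mono_of_nonneg (ae_of_all _ fun x => g0 _) ?_ (ae_of_all _ fun x => ?_)
      · exact (integrable_const (1 : ℝ)).indicator (measurableSet_iSup_eval_le _)
      · by_cases hx : ⨆ j, x j ≤ t + 2 * ε
        · rw [Set.indicator_of_mem (by exact hx)]; exact g1 _
        · rw [Set.indicator_of_notMem (by exact hx)]; exact (hzero x (not_le.1 hx)).le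
    have e : 3 / 2 * G * (Δ * L / ε ^ 2) = 3 * G * (β ^ 2 / L) * Δ / 2 := by
      rw [hβd]; field_simp
    rw [e]
    linarith [(abs_le.1 key).2]
  · intro x
    set Z := ∑ j, Real.exp (β * (x j - t)) with hZ
    have hZ0 : 0 < Z := Finset.sum_pos (fun _ _ => Real.exp_pos _) Finset.univ_nonempty
    set u := Real.log Z / L with hu
    set p : ι → ℝ := fun j => Real.exp (β * (x j - t)) / Z with hp
    have hp0 : ∀ j, 0 ≤ p j := fun j => by positivity
    have hp1 : ∑ j, p j = 1 := by rw [hp, ← Finset.sum_div, ← hZ, div_self hZ0.ne']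
    refine ⟨fun j => g₁ u * (β / L) * p j,
      fun i j => (g₂ u * (β / L) ^ 2 - g₁ u * (β ^ 2 / L)) * (p i * p j)
        + if i = j then (g₁ u * (β ^ 2 / L)) * p i else 0, ?_, fun y => ?_⟩
    · refine (sum_abs_rankOne_add_diagonal_le _ _ hp0 hp1).trans ?_
      have h1 : |g₁ u * (β ^ 2 / L)| ≤ G * (β ^ 2 / L) := by
        rw [abs_mul, abs_of_nonneg (by positivity : 0 ≤ β ^ 2 / L)]
        gcongr; exact b₁ u
      have h2 : |g₂ u * (β / L) ^ 2| ≤ G * (β ^ 2 / L) := by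
        rw [abs_mul, abs_of_nonneg (by positivity : 0 ≤ (β / L) ^ 2), div_pow]
        gcongr
        · exact b₂ u
        · nlinarith
      linarith [abs_sub (g₂ u * (β / L) ^ 2) (g₁ u * (β ^ 2 / L))]
    · have := abs_taylor_softmax_le hg hg₁ hg₂ b₁ b₂ b₃ hβ.le hL (fun j => x j - t) (fun j => y j)
        (fun j => PiLp.norm_apply_le y j) (u₀ := u) rfl rfl rfl
      rw [sum_rankOne_add_diagonal_mul]
      have e1 : (∑ j, y j * Real.exp (β * (x j - t))) / Z = ∑ j, y j * p j := by
        rw [Finset.sum_div]; exact Finset.sum_congr rfl fun j _ => by rw [hp]; ring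
      have e2 : (∑ j, y j ^ 2 * Real.exp (β * (x j - t))) / Z = ∑ j, y j ^ 2 * p j := by
        rw [Finset.sum_div]; exact Finset.sum_congr rfl fun j _ => by rw [hp]; ring
      have e3 : ∑ j, g₁ u * (β / L) * p j * y j = g₁ u * (β / L * ∑ j, y j * p j) := by
        rw [Finset.mul_sum, Finset.mul_sum]; exact Finset.sum_congr rfl fun j _ => by ring
      rw [e1, e2] at this
      rw [e3]
      have e4 : f (x + y) = g (Real.log (∑ j, Real.exp (β * (x j - t + y j))) / L) := by
        simp only [f, PiLp.add_apply]
        congr 3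
        exact Finset.sum_congr rfl fun j _ => by ring_nf
      rw [e4]
      refine le_trans (le_of_eq ?_) this
      congr 1
      simp only [f, hu]
      ring

end SmoothComparison

section FirstMax

variable {ι : Type*} [LinearOrder ι]

/-- `k` is the smallest index at which `y` attains its maximum. -/
def IsFirstMax (y : ι → ℝ) (k : ι) : Prop := (∀ i < k, y i < y k) ∧ ∀ i, y i ≤ y k

lemma IsFirstMax.eq {y : ι → ℝ} {k l : ι} (hk : IsFirstMax y k) (hl : IsFirstMax y l) : k = l := by
  rcases lt_trichotomy k l with h | h | h
  · exact absurd (hl.1 k h) (hk.2 l).not_gt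
  · exact h
  · exact absurd (hk.1 l h) (hl.2 k).not_gt

variable [Fintype ι]

lemma exists_isFirstMax [Nonempty ι] (y : ι → ℝ) : ∃ k, IsFirstMax y k := by
  classical
  obtain ⟨m, hm⟩ := Finite.exists_max y
  have hne : (Finset.univ.filter fun k => ∀ i, y i ≤ y k).Nonempty := ⟨m, by simpa using hm⟩
  have hk := Finset.min'_mem _ hne
  simp only [Finset.mem_filter, Finset.mem_univ, true_and] at hk
  refine ⟨_, fun i hi => ?_, hk⟩
  by_contra! h
  exact absurd hi (Finset.min'_le _ i (by simpa using fun l => (hk l).trans h)).not_gt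

lemma measurableSet_isFirstMax {α : Type*} [MeasurableSpace α] {y : α → ι → ℝ}
    (hy : ∀ i, Measurable fun a => y a i) (k : ι) : MeasurableSet {a | IsFirstMax (y a) k} := by
  have : {a | IsFirstMax (y a) k} =
      (⋂ i, ⋂ (_ : i < k), {a | y a i < y a k}) ∩ ⋂ i, {a | y a i ≤ y a k} := by
    ext a; simp [IsFirstMax]
  rw [this]
  exact (MeasurableSet.iInter fun i => .iInter fun _ => measurableSet_lt (hy i) (hy k)).inter
    (.iInter fun i => measurableSet_le (hy i) (hy k))

end FirstMax

section LowerTail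

variable {ι : Type*} [Fintype ι] [DecidableEq ι] {S : Matrix ι ι ℝ}

lemma integrable_exp_eval_centeredGaussian (hS : S.PosSemidef) (s : ℝ) (k : ι) :
    Integrable (fun x => Real.exp (s * x k)) (centeredGaussian S) := by
  have := integrable_exp_mul_gaussianReal (μ := 0) (v := (S k k).toNNReal) s
  rw [← map_eval_centeredGaussian hS k] at this
  exact this.comp_measurable (by fun_prop)

lemma integral_exp_eval_centeredGaussian (hS : S.PosSemidef) (s : ℝ) (k : ι) :
    ∫ x, Real.exp (s * x k) ∂(centeredGaussian S) = Real.exp (S k k * s ^ 2 / 2) := by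
  have := mgf_gaussianReal (map_eval_centeredGaussian hS k) s
  rw [mgf] at this
  rw [this, Real.coe_toNNReal _ hS.diag_nonneg]
  simp

/-- The exponential moments of a coordinate selected independently of the vector. -/
lemma integral_exp_eval_select_le (hS : S.PosSemidef) {C : ℝ} (hC : ∀ k, S k k ≤ C)
    {J : EuclideanSpace ℝ ι → ι} (hJ : ∀ k, MeasurableSet {x | J x = k}) (s : ℝ) :
    Integrable (fun p => Real.exp (s * p.2 (J p.1)))
        ((centeredGaussian S).prod (centeredGaussian S)) ∧
      ∫ p, Real.exp (s * p.2 (J p.1)) ∂((centeredGaussian S).prod (centeredGaussian S)) ≤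
        Real.exp (C * s ^ 2 / 2) := by
  set μ := centeredGaussian S
  have e : (fun p : EuclideanSpace ℝ ι × EuclideanSpace ℝ ι => Real.exp (s * p.2 (J p.1))) =
      fun p => ∑ k, ({x | J x = k}.indicator (1 : EuclideanSpace ℝ ι → ℝ) p.1) * Real.exp (s * p.2 k) := by
    ext p
    rw [Finset.sum_eq_single (J p.1)]
    · simp
    · intro k _ hk
      rw [Set.indicator_of_notMem (by simpa using hk.symm), zero_mul]
    · simp
  have hi : ∀ k, Integrable (fun p : EuclideanSpace ℝ ι × EuclideanSpace ℝ ι =>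
      ({x | J x = k}.indicator (1 : EuclideanSpace ℝ ι → ℝ) p.1) * Real.exp (s * p.2 k)) (μ.prod μ) := fun k =>
    Integrable.mul_prod ((integrable_const (1 : ℝ)).indicator (hJ k))
      (integrable_exp_eval_centeredGaussian hS s k)
  have hone : ∑ k, μ.real {x | J x = k} = 1 := by
    rw [← probReal_univ (μ := μ), ← measureReal_biUnion_finset]
    · congr 1; ext x; simp
    · intro k _ l _ hkl
      exact Set.disjoint_left.2 fun x hk hl => hkl (hk.symm.trans hl)
    · exact fun k _ => hJ k
  rw [e]
  refine ⟨integrable_finsetSum _ fun k _ => hi k, ?_⟩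
  rw [integral_finsetSum _ fun k _ => hi k]
  calc _ = ∑ k, μ.real {x | J x = k} * Real.exp (S k k * s ^ 2 / 2) := by
        refine Finset.sum_congr rfl fun k _ => ?_
        rw [integral_prod_mul (fun x => {x | J x = k}.indicator (1 : EuclideanSpace ℝ ι → ℝ) x)
          (fun y : EuclideanSpace ℝ ι => Real.exp (s * y k)),
          integral_exp_eval_centeredGaussian hS, integral_indicator_one (hJ k)]
    _ ≤ ∑ k, μ.real {x | J x = k} * Real.exp (C * s ^ 2 / 2) := by
        gcongr with k; exact hC k
    _ = _ := by rw [← Finset.sum_mul, hone, one_mul]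

lemma integrable_iSup_eval [Nonempty ι] :
    Integrable (fun x => ⨆ j, x j) (centeredGaussian S) := by
  refine Integrable.mono' (integrable_finsetSum Finset.univ fun j _ =>
    ((memLp_eval_centeredGaussian (S := S) j ENNReal.one_ne_top).integrable le_rfl).abs)
    measurable_iSup_eval.aestronglyMeasurable (ae_of_all _ fun x => ?_)
  obtain ⟨j, hj⟩ := exists_eq_ciSup_of_finite (f := fun j => x j)
  rw [← hj, Real.norm_eq_abs]
  exact Finset.single_le_sum (f := fun j => |x j|) (fun _ _ => abs_nonneg _) (Finset.mem_univ j)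

end LowerTail

section LowerTail

variable {ι : Type*} [Fintype ι] [LinearOrder ι] {S : Matrix ι ι ℝ}

/-- Lower-tail bound for the maximum of a Gaussian vector, with an exponential parameter. -/
lemma measureReal_iSup_le_mul_exp_le [Nonempty ι] (hS : S.PosSemidef) {C : ℝ}
    (hC : ∀ k, S k k ≤ C) {a : ℝ} (ha : 0 ≤ a) (s : ℝ) :
    (centeredGaussian S).real {x | ⨆ j, x j ≤ s} *
      Real.exp (a * (∫ x, (⨆ j, x j) ∂(centeredGaussian S) - 2 * s)) ≤
        Real.exp (4 * a ^ 2 * C) := by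
  set μ := centeredGaussian S with hμ
  set m := ∫ x, (⨆ j, x j) ∂μ with hm
  choose K hK using fun y : ι → ℝ => exists_isFirstMax y
  set J : EuclideanSpace ℝ ι → ι := fun x => K fun j => x j
  have hJ : ∀ x, IsFirstMax (fun j => x j) (J x) := fun x => hK _
  have hJm : ∀ k, MeasurableSet {x | J x = k} := fun k => by
    convert measurableSet_isFirstMax (y := fun (x : EuclideanSpace ℝ ι) j => x j)
      (fun i => by fun_prop) k using 3 with x
    exact ⟨fun h => h ▸ hJ x, fun h => (hJ x).eq h⟩
  obtain ⟨i1, l1⟩ := integral_exp_eval_select_le hS hC hJm (-(2 * a))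
  obtain ⟨i2, l2⟩ := integral_exp_eval_select_le hS hC hJm (-(2 * √2 * a))
  set R := ContinuousLinearMap.rotation (E := EuclideanSpace ℝ ι) (Real.pi / 4)
  have hR : (μ.prod μ).map R = μ.prod μ :=
    IsGaussian.map_rotation_eq_self (by simp [hμ, centeredGaussian]) _
  have i3 : Integrable (fun p => Real.exp (-(2 * √2 * a) * (R p).2 (J (R p).1))) (μ.prod μ) :=
    Integrable.comp_measurable (f := R)
      (g := fun p => Real.exp (-(2 * √2 * a) * p.2 (J p.1))) (hR.symm ▸ i2) R.measurable
  have l3 : ∫ p, Real.exp (-(2 * √2 * a) * (R p).2 (J (R p).1)) ∂(μ.prod μ) ≤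
      Real.exp (C * (-(2 * √2 * a)) ^ 2 / 2) := by
    rw [← integral_map (f := fun p : EuclideanSpace ℝ ι × EuclideanSpace ℝ ι =>
      Real.exp (-(2 * √2 * a) * p.2 (J p.1))) R.measurable.aemeasurable
      (hR.symm ▸ i2.aestronglyMeasurable), hR]
    exact l2
  set F : EuclideanSpace ℝ ι × EuclideanSpace ℝ ι → ℝ := fun p =>
    (Real.exp (a * (m - 2 * s)) * (1 + a * ((⨆ j, p.1 j) - m))) *
      {x | ⨆ j, x j ≤ s}.indicator (1 : EuclideanSpace ℝ ι → ℝ) p.2 with hF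
  have im : Integrable (fun x : EuclideanSpace ℝ ι => (⨆ j, x j) - m) μ :=
    integrable_iSup_eval.sub (integrable_const _)
  have iF1 : Integrable (fun x : EuclideanSpace ℝ ι =>
      Real.exp (a * (m - 2 * s)) * (1 + a * ((⨆ j, x j) - m))) μ :=
    ((integrable_const _).add (im.const_mul _)).const_mul _
  have iF : Integrable F (μ.prod μ) :=
    iF1.mul_prod ((integrable_const (1 : ℝ)).indicator (measurableSet_iSup_eval_le s))
  have eF : ∫ p, F p ∂(μ.prod μ) = Real.exp (a * (m - 2 * s)) * μ.real {x | ⨆ j, x j ≤ s} := by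
    rw [hF, integral_prod_mul (fun x : EuclideanSpace ℝ ι =>
      Real.exp (a * (m - 2 * s)) * (1 + a * ((⨆ j, x j) - m))),
      integral_indicator_one (measurableSet_iSup_eval_le s), integral_const_mul, integral_add
        (integrable_const _) (im.const_mul _),
      integral_const_mul, integral_sub integrable_iSup_eval (integrable_const _)]
    simp [hm, hμ]
  have hle : ∀ p, F p ≤ (Real.exp (-(2 * a) * p.2 (J p.1)) +
      Real.exp (-(2 * √2 * a) * (R p).2 (J (R p).1))) / 2 := by
    rintro ⟨x, y⟩
    by_cases hy : ⨆ j, y j ≤ s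
    · have hF' : F (x, y) = Real.exp (a * (m - 2 * s)) * (1 + a * ((⨆ j, x j) - m)) := by
        simp [hF, hy]
      set b := J (R (x, y)).1 with hb
      have hr1 : ∀ i, (R (x, y)).1 i = √2 / 2 * (x i + y i) := fun i => by
        simp [R, ContinuousLinearMap.rotation_apply]; ring
      have hr2 : ∀ i, (R (x, y)).2 i = √2 / 2 * (y i - x i) := fun i => by
        simp [R, ContinuousLinearMap.rotation_apply]; ring
      have hmax : x (J x) + y (J x) ≤ x b + y b := by
        have := (hJ (R (x, y)).1).2 (J x)
        simp only [← hb, hr1] at this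
        exact le_of_mul_le_mul_left this (by positivity)
      have hxs : ⨆ j, x j = x (J x) :=
        le_antisymm (ciSup_le (hJ x).2) (le_ciSup (Set.finite_range _).bddAbove (J x))
      have hyb : y b ≤ s := (le_ciSup (Set.finite_range fun j => y j).bddAbove b).trans hy
      have hv : -(2 * √2 * a) * (R (x, y)).2 b = -(2 * a) * (y b - x b) := by
        rw [hr2]
        have : √2 * √2 = 2 := Real.mul_self_sqrt (by norm_num)
        linear_combination (-a * (y b - x b)) * this
      rw [hF', hv]
      have h1 : 1 + a * ((⨆ j, x j) - m) ≤ Real.exp (a * ((⨆ j, x j) - m)) := by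
        rw [add_comm]; exact Real.add_one_le_exp _
      calc Real.exp (a * (m - 2 * s)) * (1 + a * ((⨆ j, x j) - m))
          ≤ Real.exp (a * (m - 2 * s)) * Real.exp (a * ((⨆ j, x j) - m)) := by gcongr
        _ = Real.exp (a * (x (J x) - 2 * s)) := by
            rw [← Real.exp_add, hxs]; congr 1; ring
        _ ≤ Real.exp (-a * y (J x)) * Real.exp (-a * (y b - x b)) := by
            rw [← Real.exp_add, Real.exp_le_exp]
            have : a * (x (J x) - 2 * s) ≤ a * (-y (J x) - (y b - x b)) := by
              refine mul_le_mul_of_nonneg_left ?_ ha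
              linarith
            linarith
        _ ≤ (Real.exp (-a * y (J x)) ^ 2 + Real.exp (-a * (y b - x b)) ^ 2) / 2 := by
            linarith [two_mul_le_add_sq (Real.exp (-a * y (J x))) (Real.exp (-a * (y b - x b)))]
        _ = _ := by
            rw [← Real.exp_nat_mul, ← Real.exp_nat_mul]
            congr 3 <;> · push_cast; ring
    · have : F (x, y) = 0 := by simp [hF, hy]
      rw [this]; positivity
  have hfin := integral_mono iF ((i1.add i3).div_const 2) hle
  rw [eF, mul_comm] at hfin
  refine hfin.trans ?_
  have hC0 : 0 ≤ C := by
    obtain ⟨k⟩ := ‹Nonempty ι›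
    exact hS.diag_nonneg.trans (hC k)
  simp only [Pi.add_apply]
  rw [integral_div, integral_add i1 i3]
  have h4 : Real.exp (C * (-(2 * a)) ^ 2 / 2) ≤ Real.exp (4 * a ^ 2 * C) := by
    gcongr
    nlinarith [mul_nonneg hC0 (sq_nonneg a)]
  have h5 : C * (-(2 * √2 * a)) ^ 2 / 2 = 4 * a ^ 2 * C := by
    have : √2 ^ 2 = 2 := Real.sq_sqrt (by norm_num)
    linear_combination (2 * a ^ 2 * C) * this
  rw [h5] at l3
  linarith

/-- Concentration from below: if the mean of the maximum is at least `c * r`, then the maximum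
exceeds a quarter of it except on an event of small probability. -/
lemma measureReal_iSup_le_le_exp [Nonempty ι] (hS : S.PosSemidef) {C c r : ℝ}
    (hC : ∀ k, S k k ≤ C) (hC0 : 0 < C) (hc : 0 ≤ c) (hr : 0 ≤ r)
    (hm : c * r ≤ ∫ x, (⨆ j, x j) ∂(centeredGaussian S)) :
    (centeredGaussian S).real {x | ⨆ j, x j ≤ c * r / 4} ≤
      Real.exp (-(c ^ 2 / (64 * C)) * r ^ 2) := by
  have h := measureReal_iSup_le_mul_exp_le hS hC (a := c * r / (16 * C)) (by positivity)
    (c * r / 4)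
  set I := ∫ x, (⨆ j, x j) ∂(centeredGaussian S)
  rw [← le_div_iff₀ (Real.exp_pos _), ← Real.exp_sub] at h
  refine h.trans (Real.exp_le_exp.2 ?_)
  have h1 : c * r / (16 * C) * (c * r / 2) ≤ c * r / (16 * C) * (I - 2 * (c * r / 4)) := by
    gcongr; linarith
  have h2 : 4 * (c * r / (16 * C)) ^ 2 * C - c * r / (16 * C) * (c * r / 2) =
      -(c ^ 2 / (64 * C)) * r ^ 2 := by
    field_simp; ring
  linarith

end LowerTail

section GaussianReal

lemma gaussianPDFReal_zero_one (x : ℝ) :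
    gaussianPDFReal 0 1 x = (√(2 * Real.pi))⁻¹ * Real.exp (-(x ^ 2 / 2)) := by
  simp [gaussianPDFReal, neg_div]

lemma gaussianPDFReal_zero_one_anti {a b : ℝ} (ha : 0 ≤ a) (hab : a ≤ b) :
    gaussianPDFReal 0 1 b ≤ gaussianPDFReal 0 1 a := by
  rw [gaussianPDFReal_zero_one, gaussianPDFReal_zero_one]
  gcongr

lemma gaussianReal_Icc_le {a b : ℝ} (ha : 0 ≤ a) :
    gaussianReal 0 1 (Set.Icc a b) ≤ ENNReal.ofReal ((b - a) * gaussianPDFReal 0 1 a) := by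
  rw [gaussianReal_apply _ one_ne_zero]
  calc ∫⁻ x in Set.Icc a b, gaussianPDF 0 1 x
      ≤ ∫⁻ _ in Set.Icc a b, ENNReal.ofReal (gaussianPDFReal 0 1 a) :=
        setLIntegral_mono' measurableSet_Icc fun x hx =>
          ENNReal.ofReal_le_ofReal (gaussianPDFReal_zero_one_anti ha hx.1)
    _ = _ := by
        rw [setLIntegral_const, Real.volume_Icc, mul_comm,
          ENNReal.ofReal_mul' (gaussianPDFReal_nonneg _ _ _)]

lemma le_gaussianReal_Ioo {a b : ℝ} (ha : 0 ≤ a) :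
    ENNReal.ofReal ((b - a) * gaussianPDFReal 0 1 b) ≤ gaussianReal 0 1 (Set.Ioo a b) := by
  rw [gaussianReal_apply _ one_ne_zero]
  calc _ = ∫⁻ _ in Set.Ioo a b, ENNReal.ofReal (gaussianPDFReal 0 1 b) := by
        rw [setLIntegral_const, Real.volume_Ioo, mul_comm (ENNReal.ofReal _),
          ENNReal.ofReal_mul' (gaussianPDFReal_nonneg _ _ _)]
    _ ≤ ∫⁻ x in Set.Ioo a b, gaussianPDF 0 1 x :=
        setLIntegral_mono' measurableSet_Ioo fun x hx =>
          ENNReal.ofReal_le_ofReal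
            (gaussianPDFReal_zero_one_anti (ha.trans hx.1.le) hx.2.le)

/-- Hazard-rate bound: conditionally on lying in an upper set above the level `y`, a standard
normal variable lies within `δ` of `y` with probability of order `δ * (1 + y)`. -/
lemma gaussianReal_inter_Ioc_le {A : Set ℝ} (hA : IsUpperSet A) {y δ : ℝ} (hy : 0 ≤ y) :
    gaussianReal 0 1 (A ∩ Set.Ioc y (y + δ)) ≤
      ENNReal.ofReal (13 * (δ * (1 + y))) * gaussianReal 0 1 (A ∩ Set.Ioi y) := by
  rcases (A ∩ Set.Ioc y (y + δ)).eq_empty_or_nonempty with he | hne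
  · simp [he]
  have hδ : 0 < δ := by
    obtain ⟨z, -, hz⟩ := hne
    linarith [hz.1, hz.2]
  rcases le_or_gt 1 (δ * (1 + y)) with h1 | h1
  · calc gaussianReal 0 1 (A ∩ Set.Ioc y (y + δ))
        ≤ 1 * gaussianReal 0 1 (A ∩ Set.Ioi y) := by
          rw [one_mul]
          exact measure_mono (Set.inter_subset_inter_right _ Set.Ioc_subset_Ioi_self)
      _ ≤ _ := by
          gcongr
          rw [← ENNReal.ofReal_one]
          exact ENNReal.ofReal_le_ofReal (by linarith)
  set ζ := sInf (A ∩ Set.Ioc y (y + δ)) with hζ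
  have hyζ : y ≤ ζ := le_csInf hne fun z hz => hz.2.1.le
  have hbdd : BddBelow (A ∩ Set.Ioc y (y + δ)) := ⟨y, fun z hz => hz.2.1.le⟩
  have hζδ : ζ ≤ y + δ := by
    obtain ⟨z, hz⟩ := hne
    exact (csInf_le hbdd hz).trans hz.2.2
  set η := (1 + y)⁻¹ with hη
  have hη0 : 0 < η := by positivity
  have hη1 : η ≤ 1 := inv_le_one_of_one_le₀ (by linarith)
  have hηy : η * (1 + y) = 1 := inv_mul_cancel₀ (by positivity)
  have hup : Set.Ioo ζ (ζ + η) ⊆ A ∩ Set.Ioi y := fun z hz => by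
    obtain ⟨w, hw, hwz⟩ := exists_lt_of_csInf_lt hne hz.1
    exact ⟨hA hwz.le hw.1, hyζ.trans_lt hz.1⟩
  have hlow : A ∩ Set.Ioc y (y + δ) ⊆ Set.Icc ζ (ζ + δ) := fun z hz =>
    ⟨csInf_le hbdd hz, hz.2.2.trans (by linarith)⟩
  have hexp : gaussianPDFReal 0 1 ζ ≤ 13 * gaussianPDFReal 0 1 (ζ + η) := by
    rw [gaussianPDFReal_zero_one, gaussianPDFReal_zero_one]
    have h2 : ζ * η + η ^ 2 / 2 ≤ 5 / 2 := by
      have : δ * 1 ≤ δ * (1 + y) := by gcongr; linarith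
      nlinarith [mul_le_mul_of_nonneg_right hζδ hη0.le]
    have h3 : Real.exp (5 / 2) ≤ 13 := by
      have h4 : Real.exp (5 / 2) ^ 2 ≤ 13 ^ 2 := by
        rw [← Real.exp_nat_mul]
        have : ((2 : ℕ) : ℝ) * (5 / 2) = (5 : ℕ) * 1 := by norm_num
        rw [this, Real.exp_nat_mul]
        calc Real.exp 1 ^ 5 ≤ 2.7182818286 ^ 5 := by
              gcongr; exact Real.exp_one_lt_d9.le
          _ ≤ _ := by norm_num
      exact (sq_le_sq₀ (Real.exp_pos _).le (by norm_num)).1 h4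
    calc (√(2 * Real.pi))⁻¹ * Real.exp (-(ζ ^ 2 / 2))
        = (√(2 * Real.pi))⁻¹ * (Real.exp (ζ * η + η ^ 2 / 2) * Real.exp (-((ζ + η) ^ 2 / 2))) := by
          rw [← Real.exp_add]; ring_nf
      _ ≤ (√(2 * Real.pi))⁻¹ * (13 * Real.exp (-((ζ + η) ^ 2 / 2))) := by
          gcongr
          exact (Real.exp_le_exp.2 h2).trans h3
      _ = _ := by ring
  calc gaussianReal 0 1 (A ∩ Set.Ioc y (y + δ)) ≤ gaussianReal 0 1 (Set.Icc ζ (ζ + δ)) :=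
        measure_mono hlow
    _ ≤ ENNReal.ofReal ((ζ + δ - ζ) * gaussianPDFReal 0 1 ζ) := gaussianReal_Icc_le (hy.trans hyζ)
    _ ≤ ENNReal.ofReal (13 * (δ * (1 + y)) * ((ζ + η - ζ) * gaussianPDFReal 0 1 (ζ + η))) := by
        refine ENNReal.ofReal_le_ofReal ?_
        have : 13 * (δ * (1 + y)) * ((ζ + η - ζ) * gaussianPDFReal 0 1 (ζ + η)) =
            δ * (13 * gaussianPDFReal 0 1 (ζ + η)) := by
          linear_combination (13 * δ * gaussianPDFReal 0 1 (ζ + η)) * hηy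
        rw [this, add_sub_cancel_left]
        gcongr
    _ = ENNReal.ofReal (13 * (δ * (1 + y))) *
          ENNReal.ofReal ((ζ + η - ζ) * gaussianPDFReal 0 1 (ζ + η)) :=
        ENNReal.ofReal_mul (by positivity)
    _ ≤ _ := by
        gcongr
        exact (le_gaussianReal_Ioo (hy.trans hyζ)).trans (measure_mono hup)

end GaussianReal

section Decomposition

variable {ι : Type*} [Fintype ι] [DecidableEq ι] {S : Matrix ι ι ℝ}

lemma Matrix.PosSemidef.apply_div_sqrt_le_one {ι : Type*} {S : Matrix ι ι ℝ}
    (hS : S.PosSemidef) (i k : ι) : S i k / √(S k k) / √(S i i) ≤ 1 := by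
  have hd := (hS.submatrix ![i, k]).det_nonneg
  have hsymm : S k i = S i k := hS.1.apply i k
  simp only [Matrix.det_fin_two, Matrix.submatrix_apply, Matrix.cons_val_zero,
    Matrix.cons_val_one, hsymm] at hd
  rw [div_div, ← Real.sqrt_mul hS.diag_nonneg]
  refine div_le_one_of_le₀ (Real.le_sqrt_of_sq_le ?_) (Real.sqrt_nonneg _)
  linarith

/-- Under a centered Gaussian law, a standardised coordinate is independent of the residuals of
the regression on it. -/
lemma map_residual_prod_eval_centeredGaussian (hS : S.PosSemidef) {k : ι} (hk : 0 < S k k) :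
    (centeredGaussian S).map (fun x => ((fun i => x i - S i k / S k k * x k), x k / √(S k k))) =
      ((centeredGaussian S).map (fun x i => x i - S i k / S k k * x k)).prod
        (gaussianReal 0 1) := by
  set μ := centeredGaussian S
  have hg : HasGaussianLaw (fun x : EuclideanSpace ℝ ι =>
      ((fun i => x i - S i k / S k k * x k), (fun _ : Unit => x k))) μ := by
    let L : EuclideanSpace ℝ ι →L[ℝ] (ι → ℝ) × (Unit → ℝ) :=
      (ContinuousLinearMap.pi fun i => EuclideanSpace.proj (𝕜 := ℝ) i -
        (S i k / S k k) • EuclideanSpace.proj (𝕜 := ℝ) k).prod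
        (ContinuousLinearMap.pi fun _ => EuclideanSpace.proj (𝕜 := ℝ) k)
    exact (IsGaussian.hasGaussianLaw_id (μ := μ)).map_fun L
  have hcov : ∀ i (_ : Unit), cov[fun x : EuclideanSpace ℝ ι => x i - S i k / S k k * x k,
      fun x => x k; μ] = 0 := fun i _ => by
    have m2 : ∀ i, MemLp (fun x : EuclideanSpace ℝ ι => x i) 2 μ := fun i =>
      memLp_eval_centeredGaussian i (by simp)
    rw [covariance_fun_sub_left (m2 i) ((m2 k).const_mul _) (m2 k), covariance_const_mul_left,
      covariance_eval_multivariateGaussian hS, covariance_eval_multivariateGaussian hS]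
    field_simp
    ring
  have hind := hg.indepFun_of_covariance_eval hcov
  have hind' : IndepFun (fun (x : EuclideanSpace ℝ ι) i => x i - S i k / S k k * x k)
      (fun x => x k / √(S k k)) μ :=
    hind.comp (φ := id) (ψ := fun z : Unit → ℝ => z () / √(S k k)) measurable_id (by fun_prop)
  rw [(indepFun_iff_map_prod_eq_prod_map_map (by fun_prop) (by fun_prop)).1 hind']
  congr 1
  have : (fun x : EuclideanSpace ℝ ι => x k / √(S k k)) =
      (fun z => z / √(S k k)) ∘ fun x => x k := rfl
  rw [this, ← Measure.map_map (by fun_prop) (by fun_prop), map_eval_centeredGaussian hS,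
    gaussianReal_map_div_const]
  congr 1
  · simp
  · ext
    simp [Real.sq_sqrt hk.le, hk.le, hk.ne']

end Decomposition

section AntiConcentration

variable {ι : Type*} [Fintype ι] [LinearOrder ι] {S : Matrix ι ι ℝ}

lemma measurableSet_isFirstMax_standardized (t : ℝ) (k : ι) :
    MeasurableSet {x : EuclideanSpace ℝ ι | IsFirstMax (fun i => (x i - t) / √(S i i)) k} :=
  measurableSet_isFirstMax (y := fun (x : EuclideanSpace ℝ ι) i => (x i - t) / √(S i i))
    (fun i => by fun_prop) k

/-- On the event that `k` maximises the standardised excess over `t`, the `k`-th coordinate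
rarely lies just above `t`. -/
lemma measureReal_isFirstMax_inter_le (hS : S.PosSemidef) {k : ι} (hk : 0 < S k k) {t δ : ℝ}
    (ht : 0 ≤ t) (hδ : 0 ≤ δ) :
    (centeredGaussian S).real ({x | IsFirstMax (fun i => (x i - t) / √(S i i)) k} ∩
        {x | t < x k ∧ x k ≤ t + δ}) ≤
      13 * (δ / √(S k k) * (1 + t / √(S k k))) *
        (centeredGaussian S).real {x | IsFirstMax (fun i => (x i - t) / √(S i i)) k} := by
  set μ := centeredGaussian S
  set σ := √(S k k) with hσ
  have hσ0 : 0 < σ := Real.sqrt_pos.2 hk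
  set A := {x : EuclideanSpace ℝ ι | IsFirstMax (fun i => (x i - t) / √(S i i)) k} with hA
  set Φ : EuclideanSpace ℝ ι → (ι → ℝ) × ℝ :=
    fun x => ((fun i => x i - S i k / S k k * x k), x k / σ) with hΦ
  have hΦm : Measurable Φ := by fun_prop
  set ρ := μ.map (fun (x : EuclideanSpace ℝ ι) i => x i - S i k / S k k * x k)
  have hmap : μ.map Φ = ρ.prod (gaussianReal 0 1) :=
    map_residual_prod_eval_centeredGaussian hS hk
  have hρ : IsProbabilityMeasure ρ := Measure.isProbabilityMeasure_map (by fun_prop)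
  set Y : (ι → ℝ) × ℝ → ι → ℝ := fun p i => (p.1 i + p.2 * (S i k / σ) - t) / √(S i i) with hY
  set D : Set ((ι → ℝ) × ℝ) := {p | (∀ i < k, Y p i < p.2 - t / σ) ∧ ∀ i, Y p i ≤ p.2 - t / σ}
  have hYm : ∀ i, Measurable fun p => Y p i := fun i => by fun_prop
  have hDm : MeasurableSet D := by
    have : D = (⋂ i, ⋂ (_ : i < k), {p | Y p i < p.2 - t / σ}) ∩
        ⋂ i, {p | Y p i ≤ p.2 - t / σ} := by
      ext p; simp [D]
    rw [this]
    exact (MeasurableSet.iInter fun i => .iInter fun _ =>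
      measurableSet_lt (hYm i) (by fun_prop)).inter
      (.iInter fun i => measurableSet_le (hYm i) (by fun_prop))
  have hσσ : σ * σ = S k k := Real.mul_self_sqrt hk.le
  have hAD : A = Φ ⁻¹' D := by
    ext x
    have h1 : ∀ i, Y (Φ x) i = (x i - t) / √(S i i) := fun i => by
      simp only [hY, hΦ]
      congr 2
      rw [← hσσ]
      field_simp
      ring
    have h2 : (Φ x).2 - t / σ = (x k - t) / √(S k k) := by
      simp only [hΦ, ← hσ]; ring
    simp only [hA, D, Set.mem_ofPred_eq, Set.mem_preimage, IsFirstMax, h1, h2]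
  have hup : ∀ r, IsUpperSet (Prod.mk r ⁻¹' D) := fun r z w hzw hz => by
    have hmono : ∀ i, Y (r, w) i - w ≤ Y (r, z) i - z := fun i => by
      have h1 := hS.apply_div_sqrt_le_one i k
      have h2 : (w - z) * (S i k / σ / √(S i i)) ≤ (w - z) * 1 :=
        mul_le_mul_of_nonneg_left h1 (by linarith)
      have h3 : Y (r, w) i - Y (r, z) i = (w - z) * (S i k / σ / √(S i i)) := by
        simp only [hY]; ring
      linarith
    refine ⟨fun i hi => ?_, fun i => ?_⟩
    · have := hz.1 i hi
      have := hmono i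
      dsimp only at *
      linarith
    · have := hz.2 i
      have := hmono i
      dsimp only at *
      linarith
  have key : μ (A ∩ {x | t < x k ∧ x k ≤ t + δ}) ≤
      ENNReal.ofReal (13 * (δ / σ * (1 + t / σ))) * μ A := by
    have e1 : A ∩ {x | t < x k ∧ x k ≤ t + δ} =
        Φ ⁻¹' (D ∩ Prod.snd ⁻¹' Set.Ioc (t / σ) (t / σ + δ / σ)) := by
      rw [Set.preimage_inter, hAD]
      congr 1
      ext x
      simp only [hΦ, Set.mem_ofPred_eq, Set.mem_preimage, Set.mem_Ioc, ← add_div,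
        div_lt_div_iff_of_pos_right hσ0, div_le_div_iff_of_pos_right hσ0]
    rw [e1, ← Measure.map_apply hΦm (hDm.inter (measurable_snd measurableSet_Ioc)), hmap,
      Measure.prod_apply (hDm.inter (measurable_snd measurableSet_Ioc)), hAD,
      ← Measure.map_apply hΦm hDm, hmap, Measure.prod_apply hDm,
      ← lintegral_const_mul' _ _ ENNReal.ofReal_ne_top]
    refine lintegral_mono fun r => ?_
    refine (gaussianReal_inter_Ioc_le (hup r) (by positivity)).trans ?_
    gcongr
    exact Set.inter_subset_left
  have := ENNReal.toReal_mono (ENNReal.mul_ne_top ENNReal.ofReal_ne_top (measure_ne_top _ _)) key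
  rwa [ENNReal.toReal_mul, ENNReal.toReal_ofReal (by positivity)] at this

lemma measureReal_eval_Ioc_le (hS : S.PosSemidef) {k : ι} (hk : 0 < S k k) {t δ : ℝ}
    (ht : 0 ≤ t) (hδ : 0 ≤ δ) :
    (centeredGaussian S).real {x | t < x k ∧ x k ≤ t + δ} ≤
      δ / √(S k k) * gaussianPDFReal 0 1 (t / √(S k k)) := by
  have h := map_residual_prod_eval_centeredGaussian hS hk
  have hρ : IsProbabilityMeasure ((centeredGaussian S).map
    (fun x i => x i - S i k / S k k * x k)) := Measure.isProbabilityMeasure_map (by fun_prop)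
  set σ := √(S k k) with hσ
  have hσ0 : 0 < σ := Real.sqrt_pos.2 hk
  have h2 : (centeredGaussian S).map (fun x => x k / σ) = gaussianReal 0 1 := by
    have := congrArg (Measure.map Prod.snd) h
    rw [Measure.map_map (by fun_prop) (by fun_prop), Measure.map_snd_prod] at this
    simpa [Function.comp_def] using this
  have h3 : (centeredGaussian S) {x | t < x k ∧ x k ≤ t + δ} ≤
      ENNReal.ofReal (δ / σ * gaussianPDFReal 0 1 (t / σ)) := by
    calc _ ≤ (centeredGaussian S) ((fun x => x k / σ) ⁻¹' Set.Icc (t / σ) (t / σ + δ / σ)) := by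
          refine measure_mono fun x hx => ?_
          rw [Set.mem_preimage, ← add_div]
          exact ⟨by gcongr; exact hx.1.le, by gcongr; exact hx.2⟩
      _ ≤ _ := by
          rw [← Measure.map_apply (by fun_prop) measurableSet_Icc, h2]
          refine (gaussianReal_Icc_le (by positivity)).trans (le_of_eq ?_)
          ring_nf
  refine ENNReal.toReal_le_of_le_ofReal ?_ h3
  exact mul_nonneg (by positivity) (gaussianPDFReal_nonneg _ _ _)

lemma mul_gaussianPDFReal_le_exp {y r : ℝ} (hr : 0 ≤ r) (hy : 2 * r ≤ y) :
    y * gaussianPDFReal 0 1 y ≤ Real.exp (-r ^ 2) := by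
  have h1 : y ≤ Real.exp (y ^ 2 / 4) := by
    have := Real.add_one_le_exp (y ^ 2 / 4)
    nlinarith [sq_nonneg (y - 2)]
  have h2 : (√(2 * Real.pi))⁻¹ ≤ 1 := inv_le_one_of_one_le₀ (by
    rw [Real.one_le_sqrt]; linarith [Real.two_le_pi])
  rw [gaussianPDFReal_zero_one]
  calc y * ((√(2 * Real.pi))⁻¹ * Real.exp (-(y ^ 2 / 2)))
      ≤ Real.exp (y ^ 2 / 4) * (1 * Real.exp (-(y ^ 2 / 2))) := by gcongr
    _ = Real.exp (-(y ^ 2 / 4)) := by rw [one_mul, ← Real.exp_add]; ring_nf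
    _ ≤ _ := by
      gcongr
      nlinarith

/-- Anti-concentration of the maximum of a Gaussian vector above a positive level, with no lower
bound on the variances. -/
lemma measureReal_iSup_Ioc_le [Nonempty ι] (hS : S.PosSemidef) {t δ r : ℝ} (ht : 0 < t)
    (hδ : 0 ≤ δ) (hr : 0 ≤ r) :
    (centeredGaussian S).real {x | t < ⨆ j, x j ∧ ⨆ j, x j ≤ t + δ} ≤
      δ / t * (26 * r * (1 + 2 * r) + Fintype.card ι * Real.exp (-r ^ 2)) := by
  set μ := centeredGaussian S
  set A : ι → Set (EuclideanSpace ℝ ι) :=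
    fun k => {x | IsFirstMax (fun i => (x i - t) / √(S i i)) k} with hA
  set s := Finset.univ.filter fun k => 0 < S k k with hs
  have hnull : ∀ᵐ x ∂μ, ∀ i, S i i = 0 → x i = 0 := by
    rw [ae_all_iff]
    intro i
    by_cases hi : S i i = 0
    · have h0 : ∀ᵐ z ∂(μ.map fun x => x i), z = 0 := by
        rw [map_eval_centeredGaussian hS, hi]
        simp [gaussianReal_zero_var, ae_dirac_eq]
      filter_upwards [ae_of_ae_map (by fun_prop) h0] with x hx _ using hx
    · exact ae_of_all _ fun x h => absurd h hi
  have hcover : {x : EuclideanSpace ℝ ι | t < ⨆ j, x j ∧ ⨆ j, x j ≤ t + δ} ≤ᵐ[μ]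
      ⋃ k ∈ s, A k ∩ {x | t < x k ∧ x k ≤ t + δ} := by
    filter_upwards [hnull] with x hx hM
    obtain ⟨m, hm⟩ := exists_eq_ciSup_of_finite (f := fun j => x j)
    obtain ⟨k, hk⟩ := exists_isFirstMax fun i => (x i - t) / √(S i i)
    have hM' : t < x m := hm ▸ hM.1
    have hSm : 0 < S m m := lt_of_le_of_ne hS.diag_nonneg fun h => by
      have := hx m h.symm
      linarith
    have hYm : 0 < (x m - t) / √(S m m) := div_pos (by linarith) (Real.sqrt_pos.2 hSm)
    have hYk : 0 < (x k - t) / √(S k k) := hYm.trans_le (hk.2 m)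
    have hSk : 0 < S k k := by
      by_contra! h
      simp [Real.sqrt_eq_zero_of_nonpos h] at hYk
    have hxk : t < x k := by
      have := (div_pos_iff_of_pos_right (Real.sqrt_pos.2 hSk)).1 hYk
      linarith
    refine Set.mem_biUnion (x := k) (by simpa [hs] using hSk) ⟨hk, hxk, ?_⟩
    exact (le_ciSup (Set.finite_range fun j => x j).bddAbove k).trans hM.2
  have hterm : ∀ k ∈ s, μ.real (A k ∩ {x | t < x k ∧ x k ≤ t + δ}) ≤
      δ / t * (26 * r * (1 + 2 * r) * μ.real (A k) + Real.exp (-r ^ 2)) := fun k hk => by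
    have hk' : 0 < S k k := by simpa [hs] using hk
    set σ := √(S k k) with hσ
    have hσ0 : 0 < σ := Real.sqrt_pos.2 hk'
    have hσt : δ / σ = δ / t * (t / σ) := by field_simp
    rcases le_total (t / σ) (2 * r) with h | h
    · calc _ ≤ 13 * (δ / σ * (1 + t / σ)) * μ.real (A k) :=
            measureReal_isFirstMax_inter_le hS hk' ht.le hδ
        _ = δ / t * (13 * (t / σ) * (1 + t / σ) * μ.real (A k) + 0) := by rw [hσt]; ring
        _ ≤ δ / t * (13 * (2 * r) * (1 + 2 * r) * μ.real (A k) + Real.exp (-r ^ 2)) := by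
            gcongr
            exact (Real.exp_pos _).le
        _ = _ := by ring
    · calc _ ≤ μ.real {x | t < x k ∧ x k ≤ t + δ} := measureReal_mono Set.inter_subset_right
        _ ≤ δ / σ * gaussianPDFReal 0 1 (t / σ) := measureReal_eval_Ioc_le hS hk' ht.le hδ
        _ = δ / t * (0 + t / σ * gaussianPDFReal 0 1 (t / σ)) := by rw [hσt]; ring
        _ ≤ _ := by
            gcongr
            · positivity
            · exact mul_gaussianPDFReal_le_exp hr h
  have hdisj : ∑ k ∈ s, μ.real (A k) ≤ 1 := by
    rw [← measureReal_biUnion_finset]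
    · exact measureReal_le_one
    · exact fun k _ l _ hkl => Set.disjoint_left.2 fun x hk hl => hkl (hk.eq hl)
    · exact fun k _ => measurableSet_isFirstMax_standardized t k
  calc _ ≤ μ.real (⋃ k ∈ s, A k ∩ {x | t < x k ∧ x k ≤ t + δ}) :=
        ENNReal.toReal_mono (measure_ne_top _ _) (measure_mono_ae hcover)
    _ ≤ ∑ k ∈ s, μ.real (A k ∩ {x | t < x k ∧ x k ≤ t + δ}) := measureReal_biUnion_finset_le _ _
    _ ≤ ∑ k ∈ s, δ / t * (26 * r * (1 + 2 * r) * μ.real (A k) + Real.exp (-r ^ 2)) :=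
        Finset.sum_le_sum hterm
    _ = δ / t * (26 * r * (1 + 2 * r) * ∑ k ∈ s, μ.real (A k) + s.card * Real.exp (-r ^ 2)) := by
        rw [← Finset.mul_sum, Finset.sum_add_distrib, ← Finset.mul_sum, Finset.sum_const,
          nsmul_eq_mul]
    _ ≤ δ / t * (26 * r * (1 + 2 * r) * 1 + Fintype.card ι * Real.exp (-r ^ 2)) := by
        gcongr
        exact Finset.card_le_univ s
    _ = _ := by rw [mul_one]

end AntiConcentration

section Comparison

variable {ν : ℕ} {S T : Matrix (Fin ν) (Fin ν) ℝ}

lemma measureReal_iSup_Ioc_le_of_le_integral (hν : 2 ≤ ν) (hT : T.PosSemidef) {c C : ℝ}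
    (hc : 0 < c) (hC : 0 < C) (hTC : ∀ j, T j j ≤ C)
    (hm : c * √(Real.log ν) ≤ ∫ x, (⨆ j, x j) ∂(centeredGaussian T)) (t : ℝ) {δ : ℝ}
    (hδ : 0 ≤ δ) :
    (centeredGaussian T).real {x | t < ⨆ j, x j ∧ ⨆ j, x j ≤ t + δ} ≤
      (ν : ℝ) ^ (-(c ^ 2 / (64 * C))) + 432 / c * δ * √(Real.log ν) := by
  have : NeZero ν := ⟨by lia⟩
  have hν' : (2 : ℝ) ≤ ν := by exact_mod_cast hν
  set r := √(Real.log ν) with hr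
  have hlog : (1 : ℝ) / 2 ≤ Real.log ν := by
    have := Real.log_le_log (by norm_num) hν'
    linarith [Real.log_two_gt_d9]
  have hr2 : r ^ 2 = Real.log ν := Real.sq_sqrt (by linarith)
  have hr1 : 1 ≤ 2 * r := by
    have : (1 : ℝ) / 2 ≤ r := Real.le_sqrt_of_sq_le (by linarith)
    linarith
  have hr0 : 0 < r := by linarith
  have hexp : (Fintype.card (Fin ν) : ℝ) * Real.exp (-r ^ 2) = 1 := by
    rw [Fintype.card_fin, hr2, Real.exp_neg, Real.exp_log (by linarith)]
    exact mul_inv_cancel₀ (by linarith)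
  have hpow : (ν : ℝ) ^ (-(c ^ 2 / (64 * C))) = Real.exp (-(c ^ 2 / (64 * C)) * r ^ 2) := by
    rw [Real.rpow_def_of_pos (by linarith), hr2, mul_comm]
  set s := c * r / 4 with hs
  have hs0 : 0 < s := by positivity
  have h1 := measureReal_iSup_le_le_exp hT hTC hC hc.le hr0.le hm
  have h2 := measureReal_iSup_Ioc_le hT (hs0.trans_le (le_max_right t s)) hδ hr0.le
  have hsub : {x : EuclideanSpace ℝ (Fin ν) | t < ⨆ j, x j ∧ ⨆ j, x j ≤ t + δ} ⊆
      {x | ⨆ j, x j ≤ s} ∪ {x | max t s < ⨆ j, x j ∧ ⨆ j, x j ≤ max t s + δ} := by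
    intro x hx
    rcases le_or_gt (⨆ j, x j) s with h | h
    · exact Or.inl h
    · exact Or.inr ⟨max_lt hx.1 h, hx.2.trans (by gcongr; exact le_max_left t s)⟩
  have h3 := (measureReal_mono hsub).trans (measureReal_union_le (μ := centeredGaussian T) _ _)
  rw [hpow]
  refine h3.trans (add_le_add h1 (h2.trans ?_))
  rw [hexp]
  calc δ / max t s * (26 * r * (1 + 2 * r) + 1) ≤ δ / s * (108 * r ^ 2) := by
        gcongr
        · exact le_max_right t s
        · nlinarith
    _ = 432 / c * δ * r := by rw [hs]; field_simp; ring

/-- Comparison of maxima of two Gaussian vectors at a free smoothing scale `ε`. -/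
lemma exists_abs_measureReal_iSup_le_sub_le : ∃ G : ℝ, 0 < G ∧
    ∀ {ν : ℕ} {S T : Matrix (Fin ν) (Fin ν) ℝ}, 2 ≤ ν → S.PosSemidef → T.PosSemidef →
      ∀ {c C : ℝ}, 0 < c → 0 < C → (∀ j, T j j ≤ C) →
      c * √(Real.log ν) ≤ ∫ x, (⨆ j, x j) ∂(centeredGaussian T) →
      ∀ {Δ L ε : ℝ}, 0 ≤ Δ → (∀ i j, |S i j - T i j| ≤ Δ) → 1 ≤ L → Real.log ν ≤ L → 0 < ε →
      ∀ t : ℝ, |(centeredGaussian S).real {x | ⨆ j, x j ≤ t} -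
          (centeredGaussian T).real {x | ⨆ j, x j ≤ t}| ≤
        G * (Δ * L / ε ^ 2) + (ν : ℝ) ^ (-(c ^ 2 / (64 * C))) +
          864 / c * ε * √(Real.log ν) := by
  obtain ⟨G, hG, h⟩ := exists_measureReal_iSup_le_comparison
  refine ⟨G, hG, ?_⟩
  intro ν S T hν hS hT c C hc hC hTC hm Δ L ε hΔ0 hΔ hL1 hL hε t
  have : NeZero ν := ⟨by lia⟩
  have hcard : Real.log (Fintype.card (Fin ν)) ≤ L := by simpa using hL
  have split : ∀ s, (centeredGaussian T).real {x | ⨆ j, x j ≤ s + 2 * ε} ≤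
      (centeredGaussian T).real {x | ⨆ j, x j ≤ s} + ((ν : ℝ) ^ (-(c ^ 2 / (64 * C))) +
          864 / c * ε * √(Real.log ν)) := fun s => by
    have h1 := measureReal_iSup_Ioc_le_of_le_integral hν hT hc hC hTC hm s
      (by positivity : 0 ≤ 2 * ε)
    have hsub : {x : EuclideanSpace ℝ (Fin ν) | ⨆ j, x j ≤ s + 2 * ε} ⊆
        {x | ⨆ j, x j ≤ s} ∪ {x | s < ⨆ j, x j ∧ ⨆ j, x j ≤ s + 2 * ε} := by
      intro x hx
      rcases le_or_gt (⨆ j, x j) s with h | h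
      · exact Or.inl h
      · exact Or.inr ⟨h, hx⟩
    refine ((measureReal_mono hsub).trans (measureReal_union_le _ _)).trans ?_
    gcongr
    refine h1.trans (le_of_eq ?_)
    ring
  have hΔ' : ∀ i j, |T i j - S i j| ≤ Δ := fun i j => by rw [abs_sub_comm]; exact hΔ i j
  have u1 := h hS hT hΔ0 hΔ hL1 hcard hε t
  have u2 := h hT hS hΔ0 hΔ' hL1 hcard hε (t - 2 * ε)
  have s1 := split t
  have s2 := split (t - 2 * ε)
  rw [sub_add_cancel] at u2 s2
  rw [abs_le]
  constructor <;> linarith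

end Comparison

section Transfer

variable {ι Ω : Type*} [Fintype ι] [DecidableEq ι] {mΩ : MeasurableSpace Ω} {P : Measure Ω}
  [IsProbabilityMeasure P] {V : ι → Ω → ℝ} {S : Matrix ι ι ℝ}

lemma measure_iSup_le_eq_centeredGaussian (hS : S.PosSemidef)
    (h : ∀ a : ι → ℝ, Measure.map (fun ω => ∑ j, a j * V j ω) P =
      gaussianReal 0 (∑ j₁, ∑ j₂, a j₁ * S j₁ j₂ * a j₂).toNNReal) (t : ℝ) :
    (P {ω | ⨆ j, V j ω ≤ t}).toReal = (centeredGaussian S).real {x | ⨆ j, x j ≤ t} := by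
  have hV := aemeasurable_of_linear_gaussian h
  rw [← map_toLp_eq_centeredGaussian hV hS h, measureReal_def,
    Measure.map_apply_of_aemeasurable (by fun_prop) (measurableSet_iSup_eval_le t)]
  rfl

lemma integral_iSup_eq_centeredGaussian (hS : S.PosSemidef)
    (h : ∀ a : ι → ℝ, Measure.map (fun ω => ∑ j, a j * V j ω) P =
      gaussianReal 0 (∑ j₁, ∑ j₂, a j₁ * S j₁ j₂ * a j₂).toNNReal) :
    ∫ ω, (⨆ j, V j ω) ∂P = ∫ x, (⨆ j, x j) ∂(centeredGaussian S) := by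
  have hV := aemeasurable_of_linear_gaussian h
  rw [← map_toLp_eq_centeredGaussian hV hS h,
    integral_map (by fun_prop) measurable_iSup_eval.aestronglyMeasurable]

end Transfer
/-- Gaussian comparison inequality. There exist constants `c₂, C₂ > 0`
depending only on `c₁, C₁` such that for any two centered Gaussian vectors `V, U` in `ℝ^ν`
with covariance matrices `Σ^V, Σ^U`, with `Δ₀ = max_{j₁,j₂} |Σ^V_{j₁j₂} − Σ^U_{j₁j₂}|`,
`max_j E[U_j²] ≤ C₁` and `E[max_j U_j] ≥ c₁ √(log ν)`, one has
`sup_t |P(max_j V_j ≤ t) − P(max_j U_j ≤ t)|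
  ≤ C₂ Δ₀^{1/3} (1 ∨ log(ν/Δ₀))^{2/3} + C₂ ν^{−c₂} √(1 ∨ log(ν/Δ₀))`. -/
theorem gaussian_comparison.{u}
    (c₁ C₁ : ℝ) (hc₁ : 0 < c₁) (hc₁C₁ : c₁ < C₁) :
    ∃ c₂ C₂ : ℝ, 0 < c₂ ∧ 0 < C₂ ∧
      ∀ (ν : ℕ) (Ω : Type u) (_ : MeasurableSpace Ω) (P : Measure Ω)
        (_ : IsProbabilityMeasure P)
        (V U : Fin ν → Ω → ℝ)
        (SV SU : Matrix (Fin ν) (Fin ν) ℝ),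
        SV.PosSemidef → SU.PosSemidef →
        -- `V` is centered Gaussian with covariance matrix `SV`
        (∀ a : Fin ν → ℝ, Measure.map (fun ω => ∑ j, a j * V j ω) P =
          gaussianReal 0 (∑ j₁, ∑ j₂, a j₁ * SV j₁ j₂ * a j₂).toNNReal) →
        -- `U` is centered Gaussian with covariance matrix `SU`
        (∀ a : Fin ν → ℝ, Measure.map (fun ω => ∑ j, a j * U j ω) P =
          gaussianReal 0 (∑ j₁, ∑ j₂, a j₁ * SU j₁ j₂ * a j₂).toNNReal) →
        -- `max_j E[U_j²] ≤ C₁`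
        (∀ j, SU j j ≤ C₁) →
        -- `E[max_j U_j] ≥ c₁ √(log ν)`
        (c₁ * Real.sqrt (Real.log ν) ≤ ∫ ω, (⨆ j, U j ω) ∂P) →
        ∀ t : ℝ,
          |(P {ω | (⨆ j, V j ω) ≤ t}).toReal - (P {ω | (⨆ j, U j ω) ≤ t}).toReal| ≤
            C₂ * (⨆ j₁, ⨆ j₂, |SV j₁ j₂ - SU j₁ j₂|) ^ ((1 : ℝ) / 3) *
              (max 1 (Real.log ((ν : ℝ) / (⨆ j₁, ⨆ j₂, |SV j₁ j₂ - SU j₁ j₂|)))) ^ ((2 : ℝ) / 3)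
            + C₂ * (ν : ℝ) ^ (-c₂) *
              Real.sqrt (max 1 (Real.log ((ν : ℝ) / (⨆ j₁, ⨆ j₂, |SV j₁ j₂ - SU j₁ j₂|)))) := by
  have hC₁ : 0 < C₁ := hc₁.trans hc₁C₁
  obtain ⟨G, hG, hcomp⟩ := exists_abs_measureReal_iSup_le_sub_le
  set c₂ := c₁ ^ 2 / (64 * C₁) with hc₂
  refine ⟨c₂, 1 + G + 864 / c₁, by positivity, by positivity, ?_⟩
  intro ν Ω _ P _ V U SV SU hSV hSU hV hU hUC hUm t
  set Δ := ⨆ j₁, ⨆ j₂, |SV j₁ j₂ - SU j₁ j₂| with hΔd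
  set Λ := max 1 (Real.log ((ν : ℝ) / Δ)) with hΛ
  set K := 1 + G + 864 / c₁ with hK
  have hc₁' : 0 < 864 / c₁ := by positivity
  have hK1 : 1 ≤ K := by linarith
  have hΛ1 : 1 ≤ Λ := le_max_left _ _
  have hΔ0 : 0 ≤ Δ := Real.iSup_nonneg fun _ => Real.iSup_nonneg fun _ => abs_nonneg _
  have hΔ : ∀ i j, |SV i j - SU i j| ≤ Δ := fun i j =>
    (le_ciSup (Set.finite_range fun j => |SV i j - SU i j|).bddAbove j).trans
      (le_ciSup (Set.finite_range fun i => ⨆ j, |SV i j - SU i j|).bddAbove i)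
  rw [measure_iSup_le_eq_centeredGaussian hSV hV, measure_iSup_le_eq_centeredGaussian hSU hU]
  rw [integral_iSup_eq_centeredGaussian hSU hU] at hUm
  have hsq : 1 ≤ √Λ := Real.one_le_sqrt.2 hΛ1
  have hν0 : 0 ≤ (ν : ℝ) ^ (-c₂) := Real.rpow_nonneg ν.cast_nonneg _
  have hΔ3 : 0 ≤ Δ ^ ((1 : ℝ) / 3) := Real.rpow_nonneg hΔ0 _
  have hΛ3 : 1 ≤ Λ ^ ((2 : ℝ) / 3) := Real.one_le_rpow hΛ1 (by norm_num)
  have hle : |(centeredGaussian SV).real {x | ⨆ j, x j ≤ t} -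
      (centeredGaussian SU).real {x | ⨆ j, x j ≤ t}| ≤ 1 :=
    abs_sub_le_of_nonneg_of_le measureReal_nonneg measureReal_le_one measureReal_nonneg
      measureReal_le_one
  have hR1 : 0 ≤ K * Δ ^ ((1 : ℝ) / 3) * Λ ^ ((2 : ℝ) / 3) := by positivity
  have hR2 : (ν : ℝ) ^ (-c₂) ≤ K * (ν : ℝ) ^ (-c₂) * √Λ :=
    (le_mul_of_one_le_left hν0 hK1).trans (le_mul_of_one_le_right (by positivity) hsq)
  rcases lt_or_ge ν 2 with hν | hν
  · clear_value Λ Δ K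
    obtain rfl | rfl : ν = 0 ∨ ν = 1 := by lia
    · have : (centeredGaussian SV).real {x | ⨆ j, x j ≤ t} =
          (centeredGaussian SU).real {x | ⨆ j, x j ≤ t} := by
        simp only [Real.iSup_of_isEmpty]
        by_cases ht : 0 ≤ t <;> simp [ht]
      rw [this, sub_self, abs_zero]
      exact add_nonneg hR1 (hν0.trans hR2)
    · have : ((1 : ℕ) : ℝ) ^ (-c₂) = 1 := by simp
      exact hle.trans ((this.ge.trans hR2).trans (le_add_of_nonneg_left hR1))
  have hν' : (2 : ℝ) ≤ ν := by exact_mod_cast hν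
  have hlog0 : 0 ≤ Real.log ν := Real.log_nonneg (by linarith)
  rcases hΔ0.eq_or_lt with h0 | h0
  · refine le_trans (le_of_forall_pos_le_add fun ε hε => ?_)
      (hR2.trans (le_add_of_nonneg_left hR1))
    set r := √(Real.log ν)
    have hr : 0 ≤ r := Real.sqrt_nonneg _
    have := hcomp hν hSV hSU hc₁ hC₁ hUC hUm hΔ0 hΔ (le_max_left 1 (Real.log ν))
      (le_max_right 1 (Real.log ν)) (by positivity : 0 < ε / (864 / c₁ * r + 1)) t
    refine this.trans ?_
    have h1 : 864 / c₁ * (ε / (864 / c₁ * r + 1)) * r ≤ ε := by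
      rw [mul_div_assoc', div_mul_eq_mul_div, div_le_iff₀ (by positivity)]
      nlinarith
    rw [← h0]
    simp only [zero_mul, zero_div, mul_zero, zero_add]
    linarith
  rcases lt_or_ge 1 Δ with h1 | h1
  · have : 1 ≤ Δ ^ ((1 : ℝ) / 3) := Real.one_le_rpow h1.le (by norm_num)
    have h2 : 1 ≤ K * Δ ^ ((1 : ℝ) / 3) * Λ ^ ((2 : ℝ) / 3) :=
      one_le_mul_of_one_le_of_one_le (one_le_mul_of_one_le_of_one_le hK1 this) hΛ3
    linarith
  · have hlogΛ : Real.log ν ≤ Λ :=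
      (Real.log_le_log (by linarith) (le_div_self (by linarith) h0 h1)).trans (le_max_right _ _)
    have hΛ0 : 0 < Λ := by linarith
    set a := Δ ^ ((1 : ℝ) / 3) with ha
    set b := Λ ^ ((1 : ℝ) / 6) with hb
    have ha0 : 0 < a := Real.rpow_pos_of_pos h0 _
    have hb0 : 0 < b := Real.rpow_pos_of_pos hΛ0 _
    have ha3 : a ^ 3 = Δ := by
      rw [ha, ← Real.rpow_natCast, ← Real.rpow_mul hΔ0]; norm_num
    have hb6 : b ^ 6 = Λ := by
      rw [hb, ← Real.rpow_natCast, ← Real.rpow_mul hΛ0.le]; norm_num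
    have hb4 : b ^ 4 = Λ ^ ((2 : ℝ) / 3) := by
      rw [hb, ← Real.rpow_natCast, ← Real.rpow_mul hΛ0.le]; norm_num
    have hr : √(Real.log ν) ≤ b ^ 3 := by
      rw [Real.sqrt_le_left (by positivity), ← pow_mul, hb6]
      exact hlogΛ
    have := hcomp hν hSV hSU hc₁ hC₁ hUC hUm hΔ0 hΔ hΛ1 hlogΛ (by positivity : 0 < a * b) t
    refine this.trans ?_
    have e1 : Δ * Λ / (a * b) ^ 2 = a * b ^ 4 := by
      rw [← ha3, ← hb6]; field_simp
    have e2 : 864 / c₁ * (a * b) * √(Real.log ν) ≤ 864 / c₁ * (a * b ^ 4) := by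
      calc _ ≤ 864 / c₁ * (a * b) * b ^ 3 := by gcongr
        _ = _ := by ring
    rw [e1, ← hb4]
    have e3 : (G + 864 / c₁) * (a * b ^ 4) ≤ K * (a * b ^ 4) := by
      gcongr; linarith
    linarith
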